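/- arXiv:0808.4114 — 6 statements merged into one kernel-verified Lean document; each statement's English description precedes it below -/
import Mathlib

section
/- Let R be a UFD with field of fractions K. Let A, B ∈ R[X] with A(0) = B(0) = 0, and let b ∈ R be nonzero with gcd(B, b) = 1. If the polynomial A(B(X)/b), computed in K[X], has all of its coefficients in R, then there exists C ∈ R[X] such that A(X) = C(bX). -/
open Polynomial

namespace Polynomial

theorem C_dvd_iff_map_quotient_mk_eq_zero {R : Type*} [CommRing R] (p : R) (P : R[X]) :
    C p ∣ P ↔ P.map (Ideal.Quotient.mk (Ideal.span {p})) = 0 := by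
  simp [C_dvd_iff_dvd_coeff, Polynomial.ext_iff, Ideal.Quotient.eq_zero_iff_mem,
    Ideal.mem_span_singleton]

theorem C_prime_dvd_of_dvd_comp {R : Type*} [CommRing R] {p : R} (hp : Prime p)
    {P B : R[X]} (hB0 : B.coeff 0 = 0) (hB : ¬ C p ∣ B) (h : C p ∣ P.comp B) : C p ∣ P := by
  rw [C_dvd_iff_map_quotient_mk_eq_zero] at *
  have : (Ideal.span {p}).IsPrime := (Ideal.span_singleton_prime hp.ne_zero).2 hp
  rw [Polynomial.map_comp, comp_eq_zero_iff] at h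
  refine h.resolve_right fun h' => hB ?_
  simpa [hB0] using h'.2

theorem C_dvd_of_dvd_comp {R : Type*} [CommRing R] [IsDomain R] [UniqueFactorizationMonoid R]
    {B : R[X]} (hB0 : B.coeff 0 = 0) {q : R} (hq : q ≠ 0)
    (hB : ∀ p, Prime p → p ∣ q → ¬ C p ∣ B) {P : R[X]} (h : C q ∣ P.comp B) : C q ∣ P := by
  induction q using UniqueFactorizationMonoid.induction_on_prime generalizing P with
  | h₁ => exact absurd rfl hq
  | h₂ x hx => exact (isUnit_C.2 hx).dvd
  | h₃ a p ha hp ih =>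
    have hdvd : C p ∣ P.comp B := (_root_.map_dvd C (dvd_mul_right p a)).trans h
    obtain ⟨P, rfl⟩ := C_prime_dvd_of_dvd_comp hp hB0 (hB p hp (dvd_mul_right p a)) hdvd
    have hp0 : (C p : R[X]) ≠ 0 := C_ne_zero.2 hp.ne_zero
    rw [C_mul] at h ⊢
    rw [mul_comp, C_comp, mul_dvd_mul_iff_left hp0] at h
    exact mul_dvd_mul_left _
      (ih ha (fun r hr hra => hB r hr (hra.mul_left p)) h)

theorem exists_eq_comp_C_mul_X {R : Type*} [CommRing R] {A : R[X]} {b : R}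
    (h : ∀ i, b ^ i ∣ A.coeff i) : ∃ D : R[X], A = D.comp (C b * X) := by
  choose c hc using h
  refine ⟨∑ i ∈ Finset.range (A.natDegree + 1), C (c i) * X ^ i, ?_⟩
  conv_lhs => rw [A.as_sum_range_C_mul_X_pow]
  rw [comp, eval₂_finsetSum]
  refine Finset.sum_congr rfl fun i _ => ?_
  simp only [eval₂_mul, eval₂_C, eval₂_X_pow, hc i, C_mul, C_pow, mul_pow]
  ring

end Polynomial

/-- Let `R` be a UFD with fraction field `K`. If `A, B ∈ R[X]` with
`A(0) = B(0) = 0`, `b ∈ R` is nonzero with `gcd(B, b) = 1` (no common non-unit divisor of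
`B` and the constant polynomial `b`), and the polynomial `A(B(X)/b)`, computed in `K[X]`,
has all of its coefficients in `R`, then `A(X) = C(bX)` for some `C ∈ R[X]`. -/
theorem stmt_0 {R : Type*} [CommRing R] [IsDomain R] [UniqueFactorizationMonoid R]
    (A B : Polynomial R) (hA0 : Polynomial.eval 0 A = 0) (hB0 : Polynomial.eval 0 B = 0)
    (b : R) (hb : b ≠ 0)
    (hgcd : ∀ d : Polynomial R, d ∣ B → d ∣ Polynomial.C b → IsUnit d)
    (hint : ∀ n : ℕ,
      ((A.map (algebraMap R (FractionRing R))).comp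
          (Polynomial.C ((algebraMap R (FractionRing R)) b)⁻¹ *
            B.map (algebraMap R (FractionRing R)))).coeff n
        ∈ Set.range (algebraMap R (FractionRing R))) :
    ∃ C : Polynomial R, A = C.comp (Polynomial.C b * Polynomial.X) := by
  let f := algebraMap R (FractionRing R)
  have hfb : f b ≠ 0 := by simpa [f] using hb
  have hB0' : B.coeff 0 = 0 := by rwa [coeff_zero_eq_eval_zero]
  have hf : Function.Injective f := IsFractionRing.injective R (FractionRing R)
  have hscale : ((A.scaleRoots b).comp B).map f =
      C (f b ^ A.natDegree) * (A.map f).comp (C (f b)⁻¹ * B.map f) := by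
    have key := scaleRoots_eval₂_mul (p := A) (C.comp f) (C (f b)⁻¹ * B.map f) b
    have hcancel : (C.comp f) b * (C (f b)⁻¹ * B.map f) = B.map f := by
      rw [RingHom.comp_apply, ← mul_assoc, ← C_mul, mul_inv_cancel₀ hfb, C_1, one_mul]
    rw [hcancel] at key
    rw [Polynomial.map_comp, comp, comp, eval₂_map, eval₂_map, key, RingHom.comp_apply, C_pow]
  have hdvd : C (b ^ A.natDegree) ∣ (A.scaleRoots b).comp B := by
    rw [C_dvd_iff_dvd_coeff]
    intro n
    obtain ⟨r, hr⟩ := hint n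
    refine ⟨r, hf ?_⟩
    rw [← coeff_map, hscale, coeff_C_mul, map_mul, map_pow]
    exact congrArg _ hr.symm
  have hprime : ∀ p, Prime p → p ∣ b ^ A.natDegree → ¬ C p ∣ B := fun p hp hpb hpB =>
    hp.not_isUnit (isUnit_C.1 (hgcd _ hpB (_root_.map_dvd C (hp.dvd_of_dvd_pow hpb))))
  have hcoeff := C_dvd_iff_dvd_coeff _ _ |>.1
    (C_dvd_of_dvd_comp hB0' (pow_ne_zero _ hb) hprime hdvd)
  refine exists_eq_comp_C_mul_X fun i => ?_
  rcases le_or_gt i A.natDegree with hi | hi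
  · have h := hcoeff i
    rw [coeff_scaleRoots, ← Nat.add_sub_cancel' hi, pow_add, Nat.add_sub_cancel' hi] at h
    exact (mul_dvd_mul_iff_right (pow_ne_zero _ hb)).1 h
  · simp [coeff_eq_zero_of_natDegree_lt hi]
end

section
/- Let R be a UFD with field of fractions K. Let A, B ∈ R[X] with A(0) = B(0) = 0, and let b ∈ R be nonzero with gcd(B, b) = 1. If the polynomial A(B(X)/b), computed in K[X], has all of its coefficients in R, then for every k ≥ 1 the coefficient of X^k in A is divisible by b^k in R. -/
open Polynomial in
/-- If `B(0) = 0` and the prime `p` does not divide `B`, then divisibility by `p` descends along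
composition with `B`. -/
theorem C_dvd_of_C_dvd_comp {R : Type*} [CommRing R] {p : R} (hp : Prime p)
    {B : R[X]} (hB0 : B.eval 0 = 0) (hpB : ¬ C p ∣ B) {F : R[X]} (h : C p ∣ F.comp B) :
    C p ∣ F := by
  have key (G : R[X]) : C p ∣ G ↔ G.map (Ideal.Quotient.mk (Ideal.span {p})) = 0 := by
    simp [C_dvd_iff_dvd_coeff, Polynomial.ext_iff, Ideal.Quotient.eq_zero_iff_dvd]
  have : (Ideal.span {p}).IsPrime := (Ideal.span_singleton_prime hp.ne_zero).2 hp
  rw [key] at h hpB ⊢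
  rw [Polynomial.map_comp, comp_eq_zero_iff] at h
  refine h.resolve_right fun ⟨_, hC⟩ => hpB ?_
  rw [hC, coeff_map, coeff_zero_eq_eval_zero, hB0, map_zero, C_0]

open Polynomial in
/-- If `B(0) = 0` and no prime dividing `d` divides `B`, then divisibility by `d` descends along
composition with `B`. -/
theorem C_dvd_of_C_dvd_comp_of_forall_prime {R : Type*} [CommRing R] [IsDomain R]
    [UniqueFactorizationMonoid R] {B : R[X]} (hB0 : B.eval 0 = 0) {d : R} (hd : d ≠ 0)
    (hdB : ∀ p : R, Prime p → p ∣ d → ¬ C p ∣ B) {F : R[X]} (h : C d ∣ F.comp B) :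
    C d ∣ F := by
  induction d using UniqueFactorizationMonoid.induction_on_prime generalizing F with
  | h₁ => exact absurd rfl hd
  | h₂ x hx => exact (isUnit_C.2 hx).dvd
  | h₃ a p ha hp ih =>
    rw [C_mul] at h ⊢
    obtain ⟨G, rfl⟩ := C_dvd_of_C_dvd_comp hp hB0 (hdB p hp (dvd_mul_right p a))
      (dvd_of_mul_right_dvd h)
    rw [mul_comp, C_comp, mul_dvd_mul_iff_left (C_ne_zero.2 hp.ne_zero)] at h
    exact mul_dvd_mul_left _ (ih ha (fun q hq hqa => hdB q hq (hqa.mul_left p)) h)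

/-- Let `R` be a UFD with fraction field `K`. If `A, B ∈ R[X]` with
`A(0) = B(0) = 0`, `b ∈ R` is nonzero with `gcd(B, b) = 1` (no common non-unit divisor of
`B` and the constant polynomial `b`), and the polynomial `A(B(X)/b)`, computed in `K[X]`,
has all of its coefficients in `R`, then for every `k ≥ 1` the coefficient of `X^k` in `A`
is divisible by `b^k` in `R`. -/
theorem stmt_1 {R : Type*} [CommRing R] [IsDomain R] [UniqueFactorizationMonoid R]
    (A B : Polynomial R) (hA0 : Polynomial.eval 0 A = 0) (hB0 : Polynomial.eval 0 B = 0)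
    (b : R) (hb : b ≠ 0)
    (hgcd : ∀ d : Polynomial R, d ∣ B → d ∣ Polynomial.C b → IsUnit d)
    (hint : ∀ n : ℕ,
      ((A.map (algebraMap R (FractionRing R))).comp
          (Polynomial.C ((algebraMap R (FractionRing R)) b)⁻¹ *
            B.map (algebraMap R (FractionRing R)))).coeff n
        ∈ Set.range (algebraMap R (FractionRing R))) :
    ∀ k : ℕ, 1 ≤ k → b ^ k ∣ A.coeff k := by
  intro k _
  have hcomp : Polynomial.C (b ^ A.natDegree) ∣ (A.scaleRoots b).comp B := by
    rw [Polynomial.C_dvd_iff_dvd_coeff]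
    intro n
    obtain ⟨c, hc⟩ := hint n
    refine ⟨c, IsFractionRing.injective R (FractionRing R) ?_⟩
    have hbK : algebraMap R (FractionRing R) b ≠ 0 := by simpa using hb
    have h := Polynomial.scaleRoots_eval₂_mul (p := A)
      (Polynomial.C.comp (algebraMap R (FractionRing R)))
      (Polynomial.C (algebraMap R (FractionRing R) b)⁻¹ * B.map (algebraMap R (FractionRing R))) b
    rw [RingHom.comp_apply, ← mul_assoc, ← Polynomial.C_mul, mul_inv_cancel₀ hbK, Polynomial.C_1,
      one_mul, ← Polynomial.eval₂_map, ← Polynomial.eval₂_map, ← Polynomial.comp,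
      ← Polynomial.comp, ← Polynomial.map_comp, ← Polynomial.C_pow] at h
    rw [← Polynomial.coeff_map, h, Polynomial.coeff_C_mul, ← hc, map_mul, map_pow]
  have hdvd := C_dvd_of_C_dvd_comp_of_forall_prime hB0 (pow_ne_zero _ hb)
    (fun p hp hpb hpB => hp.not_isUnit <| Polynomial.isUnit_C.1 <|
      hgcd _ hpB (Polynomial.C.map_dvd (hp.dvd_of_dvd_pow hpb))) hcomp
  rcases lt_or_ge A.natDegree k with hk | hk
  · simp [Polynomial.coeff_eq_zero_of_natDegree_lt hk]
  · have h := (Polynomial.C_dvd_iff_dvd_coeff _ _).1 hdvd k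
    rw [Polynomial.coeff_scaleRoots, ← Nat.add_sub_cancel' hk, pow_add,
      Nat.add_sub_cancel_left] at h
    exact (mul_dvd_mul_iff_right (pow_ne_zero _ hb)).1 h
end

section
/- Let R be a UFD with field of fractions K. Let a, b ∈ R be nonzero with gcd(a, b) = 1, and let C ∈ R[X], D ∈ R[Y] with C(0) = D(0) = 0. Set F₁ = (X, Y + C(bX)/a), G₁ = (X + D(aY)/b, Y), and F = G₁⁻¹∘F₁⁻¹∘G₁∘F₁ (applying F₁ first). Assume F ∈ Aut₂(R) and that a divides every coefficient of D. Then the elements P := (D(aY + C(bX)) − D(aY + C(bX) − C(bX + D(aY + C(bX)))))/(ab) and Q := (C(bX) − C(bX + D(aY + C(bX))))/a of K[X,Y] have all of their coefficients in R, and F = (X + aP, Y + Q). -/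
noncomputable section

/-- A polynomial map `(P(X,Y), Q(X,Y))` of the plane, given by a pair of polynomials. -/
abbrev PolyPair (K : Type*) [CommSemiring K] :=
  MvPolynomial (Fin 2) K × MvPolynomial (Fin 2) K

/-- Composition of polynomial maps: `pcomp G F = G ∘ F` (the map `F` is applied first). -/
def pcomp {K : Type*} [CommSemiring K] (G F : PolyPair K) : PolyPair K :=
  (MvPolynomial.aeval ![F.1, F.2] G.1, MvPolynomial.aeval ![F.1, F.2] G.2)

/-- The identity polynomial map `(X, Y)`. -/
def idPair (K : Type*) [CommSemiring K] : PolyPair K :=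
  (MvPolynomial.X 0, MvPolynomial.X 1)

/-- All coefficients of `p` lie in (the image of) `R`. -/
def CoeffsIn (R : Type*) {K : Type*} [CommSemiring R] [CommSemiring K] [Algebra R K]
    (p : MvPolynomial (Fin 2) K) : Prop :=
  ∀ m : Fin 2 →₀ ℕ, p.coeff m ∈ Set.range (algebraMap R K)

/-- `F ∈ Aut₂(R)`: the polynomial map `F` over `K` is invertible (hence corresponds to an
automorphism over `K`) and both coordinate polynomials of `F` and of its inverse have all
of their coefficients in `R`. -/
def MemAut2 (R : Type*) {K : Type*} [CommSemiring R] [CommSemiring K] [Algebra R K]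
    (F : PolyPair K) : Prop :=
  CoeffsIn R F.1 ∧ CoeffsIn R F.2 ∧
    ∃ G : PolyPair K, CoeffsIn R G.1 ∧ CoeffsIn R G.2 ∧
      pcomp F G = idPair K ∧ pcomp G F = idPair K

/-- The elementary polynomial map `(X, Y + p(X))`. -/
def elemF {K : Type*} [CommSemiring K] (p : Polynomial K) : PolyPair K :=
  (MvPolynomial.X 0, MvPolynomial.X 1 + Polynomial.aeval (MvPolynomial.X 0) p)

/-- The elementary polynomial map `(X + p(Y), Y)`. -/
def elemG {K : Type*} [CommSemiring K] (p : Polynomial K) : PolyPair K :=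
  (MvPolynomial.X 0 + Polynomial.aeval (MvPolynomial.X 1) p, MvPolynomial.X 1)

end

noncomputable section

/-- `P := (D(aY + C(bX)) − D(aY + C(bX) − C(bX + D(aY + C(bX)))))/(ab)` in `K[X,Y]`. -/
def Pexpr {R : Type*} [CommRing R] [IsDomain R] (a b : R) (C D : Polynomial R) :
    MvPolynomial (Fin 2) (FractionRing R) :=
  let f := algebraMap R (FractionRing R)
  let X0 : MvPolynomial (Fin 2) (FractionRing R) := MvPolynomial.X 0
  let Y0 : MvPolynomial (Fin 2) (FractionRing R) := MvPolynomial.X 1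
  let cBX := Polynomial.aeval (MvPolynomial.C (f b) * X0) (C.map f)
  let u := Polynomial.aeval (MvPolynomial.C (f a) * Y0 + cBX) (D.map f)
  let cBXD := Polynomial.aeval (MvPolynomial.C (f b) * X0 + u) (C.map f)
  MvPolynomial.C (f a * f b)⁻¹ *
    (u - Polynomial.aeval (MvPolynomial.C (f a) * Y0 + cBX - cBXD) (D.map f))

/-- `Q := (C(bX) − C(bX + D(aY + C(bX))))/a` in `K[X,Y]`. -/
def Qexpr {R : Type*} [CommRing R] [IsDomain R] (a b : R) (C D : Polynomial R) :
    MvPolynomial (Fin 2) (FractionRing R) :=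
  let f := algebraMap R (FractionRing R)
  let X0 : MvPolynomial (Fin 2) (FractionRing R) := MvPolynomial.X 0
  let Y0 : MvPolynomial (Fin 2) (FractionRing R) := MvPolynomial.X 1
  let cBX := Polynomial.aeval (MvPolynomial.C (f b) * X0) (C.map f)
  let u := Polynomial.aeval (MvPolynomial.C (f a) * Y0 + cBX) (D.map f)
  let cBXD := Polynomial.aeval (MvPolynomial.C (f b) * X0 + u) (C.map f)
  MvPolynomial.C (f a)⁻¹ * (cBX - cBXD)

theorem coeffsIn_of_add_left {R K : Type*} [CommRing R] [CommRing K] [Algebra R K]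
    {p q : MvPolynomial (Fin 2) K} (hp : CoeffsIn R p) (hpq : CoeffsIn R (p + q)) :
    CoeffsIn R q := fun m => by
  obtain ⟨r, hr⟩ := hpq m
  obtain ⟨s, hs⟩ := hp m
  exact ⟨r - s, by rw [map_sub, hr, hs, MvPolynomial.coeff_add, add_sub_cancel_left]⟩

theorem coeffsIn_map {R K : Type*} [CommSemiring R] [CommSemiring K] [Algebra R K]
    (q : MvPolynomial (Fin 2) R) : CoeffsIn R (MvPolynomial.map (algebraMap R K) q) :=
  fun m => ⟨q.coeff m, (MvPolynomial.coeff_map _ _ _).symm⟩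

theorem mem_range_of_relPrime_mul_mem_range {R : Type*} [CommRing R] [IsDomain R]
    [UniqueFactorizationMonoid R] {a b : R} (ha : a ≠ 0) (hab : IsRelPrime a b)
    {c : FractionRing R}
    (hac : algebraMap R (FractionRing R) a * c ∈ Set.range (algebraMap R (FractionRing R)))
    (hbc : algebraMap R (FractionRing R) b * c ∈ Set.range (algebraMap R (FractionRing R))) :
    c ∈ Set.range (algebraMap R (FractionRing R)) := by
  obtain ⟨r, hr⟩ := hac
  obtain ⟨s, hs⟩ := hbc
  have hinj := IsFractionRing.injective R (FractionRing R)
  have hrs : b * r = a * s := by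
    apply hinj
    rw [map_mul, map_mul, hr, hs]
    ring
  obtain ⟨t, rfl⟩ : a ∣ r := hab.dvd_of_dvd_mul_left ⟨s, hrs⟩
  have hfa : algebraMap R (FractionRing R) a ≠ 0 := (map_ne_zero_iff _ hinj).2 ha
  exact ⟨t, mul_left_cancel₀ hfa (by rw [← hr, map_mul])⟩

theorem coeffsIn_of_relPrime_mul {R : Type*} [CommRing R] [IsDomain R]
    [UniqueFactorizationMonoid R] {a b : R} (ha : a ≠ 0) (hab : IsRelPrime a b)
    {p : MvPolynomial (Fin 2) (FractionRing R)}
    (hap : CoeffsIn R (MvPolynomial.C (algebraMap R (FractionRing R) a) * p))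
    (hbp : CoeffsIn R (MvPolynomial.C (algebraMap R (FractionRing R) b) * p)) :
    CoeffsIn R p := fun m =>
  mem_range_of_relPrime_mul_mem_range ha hab
    (by simpa only [MvPolynomial.coeff_C_mul] using hap m)
    (by simpa only [MvPolynomial.coeff_C_mul] using hbp m)

theorem map_aeval_eq_aeval_map {R K : Type*} [CommRing R] [CommRing K] (f : R →+* K)
    (p : Polynomial R) (q : MvPolynomial (Fin 2) R) :
    MvPolynomial.map f (Polynomial.aeval q p) =
      Polynomial.aeval (MvPolynomial.map f q) (p.map f) := by
  rw [Polynomial.aeval_def, Polynomial.hom_eval₂, Polynomial.aeval_def, Polynomial.eval₂_map]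
  congr 1
  ext r : 1
  simp [MvPolynomial.algebraMap_eq]

theorem aeval_C_mul_comp {K A : Type*} [Field K] [CommRing A] [Algebra K A]
    (c d : K) (p : Polynomial K) (q : A) :
    Polynomial.aeval q (Polynomial.C c * p.comp (Polynomial.C d * Polynomial.X)) =
      algebraMap K A c * Polynomial.aeval (algebraMap K A d * q) p := by
  simp [Polynomial.aeval_comp]

theorem commutator_elem_eq {K : Type*} [Field K] (p q : Polynomial K) :
    pcomp (elemG (-q)) (pcomp (elemF (-p)) (pcomp (elemG q) (elemF p))) =
      let y₁ : MvPolynomial (Fin 2) K := MvPolynomial.X 1 + Polynomial.aeval (MvPolynomial.X 0) p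
      let x₁ := MvPolynomial.X 0 + Polynomial.aeval y₁ q
      let y₂ := y₁ - Polynomial.aeval x₁ p
      (x₁ - Polynomial.aeval y₂ q, y₂) := by
  simp [pcomp, elemF, elemG, ← Polynomial.aeval_algHom_apply, sub_eq_add_neg]

theorem commutator_eq_add_Pexpr_Qexpr {R : Type*} [CommRing R] [IsDomain R]
    {a b : R} (ha : a ≠ 0) (hb : b ≠ 0) (C D : Polynomial R) :
    pcomp
        (elemG (-(Polynomial.C ((algebraMap R (FractionRing R)) b)⁻¹ *
          (D.map (algebraMap R (FractionRing R))).comp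
            (Polynomial.C ((algebraMap R (FractionRing R)) a) * Polynomial.X))))
        (pcomp
          (elemF (-(Polynomial.C ((algebraMap R (FractionRing R)) a)⁻¹ *
            (C.map (algebraMap R (FractionRing R))).comp
              (Polynomial.C ((algebraMap R (FractionRing R)) b) * Polynomial.X))))
          (pcomp
            (elemG (Polynomial.C ((algebraMap R (FractionRing R)) b)⁻¹ *
              (D.map (algebraMap R (FractionRing R))).comp
                (Polynomial.C ((algebraMap R (FractionRing R)) a) * Polynomial.X)))
            (elemF (Polynomial.C ((algebraMap R (FractionRing R)) a)⁻¹ *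
              (C.map (algebraMap R (FractionRing R))).comp
                (Polynomial.C ((algebraMap R (FractionRing R)) b) * Polynomial.X))))) =
      (MvPolynomial.X 0 + MvPolynomial.C ((algebraMap R (FractionRing R)) a) * Pexpr a b C D,
       MvPolynomial.X 1 + Qexpr a b C D) := by
  have hinj := IsFractionRing.injective R (FractionRing R)
  have hfa : algebraMap R (FractionRing R) a ≠ 0 := (map_ne_zero_iff _ hinj).2 ha
  have hfb : algebraMap R (FractionRing R) b ≠ 0 := (map_ne_zero_iff _ hinj).2 hb
  rw [commutator_elem_eq]
  simp only [aeval_C_mul_comp, MvPolynomial.algebraMap_eq, Pexpr, Qexpr]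
  generalize algebraMap R (FractionRing R) a = α at *
  generalize algebraMap R (FractionRing R) b = β at *
  have cancel (γ : FractionRing R) (h : γ ≠ 0) (p : MvPolynomial (Fin 2) (FractionRing R)) :
      MvPolynomial.C γ * (MvPolynomial.C γ⁻¹ * p) = p := by
    rw [← mul_assoc, ← map_mul, mul_inv_cancel₀ h, map_one, one_mul]
  simp only [mul_add, mul_sub, cancel α hfa, cancel β hfb, mul_inv, map_mul, mul_assoc]
  ext1 <;> ring

theorem coeffsIn_C_mul_Pexpr_of_dvd_coeff {R : Type*} [CommRing R] [IsDomain R]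
    {a b : R} (ha : a ≠ 0) (hb : b ≠ 0) (C D : Polynomial R) (haD : ∀ k : ℕ, a ∣ D.coeff k) :
    CoeffsIn R (MvPolynomial.C (algebraMap R (FractionRing R) b) * Pexpr a b C D) := by
  have hinj := IsFractionRing.injective R (FractionRing R)
  have hfa : algebraMap R (FractionRing R) a ≠ 0 := (map_ne_zero_iff _ hinj).2 ha
  have hfb : algebraMap R (FractionRing R) b ≠ 0 := (map_ne_zero_iff _ hinj).2 hb
  obtain ⟨E, rfl⟩ := (Polynomial.C_dvd_iff_dvd_coeff a D).2 haD
  let c : MvPolynomial (Fin 2) R := Polynomial.aeval (MvPolynomial.C b * MvPolynomial.X 0) C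
  let v : MvPolynomial (Fin 2) R := MvPolynomial.C a * MvPolynomial.X 1 + c
  let w : MvPolynomial (Fin 2) R := Polynomial.aeval
    (MvPolynomial.C b * MvPolynomial.X 0 + Polynomial.aeval v (Polynomial.C a * E)) C
  convert coeffsIn_map (K := FractionRing R) (Polynomial.aeval v E - Polynomial.aeval (v - w) E)
    using 1
  have hone : MvPolynomial.C (σ := Fin 2) (algebraMap R (FractionRing R) b) *
      MvPolynomial.C (algebraMap R (FractionRing R) a * algebraMap R (FractionRing R) b)⁻¹ *
      MvPolynomial.C (algebraMap R (FractionRing R) a) = 1 := by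
    rw [← map_mul, ← map_mul, ← map_one MvPolynomial.C]
    congr 1
    field_simp
  simp only [Pexpr, v, w, c, map_sub, map_add, map_mul, map_aeval_eq_aeval_map,
    MvPolynomial.map_C, MvPolynomial.map_X, Polynomial.map_mul, Polynomial.map_C,
    Polynomial.aeval_C, MvPolynomial.algebraMap_eq]
  rw [← mul_sub, ← mul_assoc, ← mul_assoc, hone, one_mul]

/-- With `F₁ = (X, Y + C(bX)/a)`, `G₁ = (X + D(aY)/b, Y)` and
`F = G₁⁻¹∘F₁⁻¹∘G₁∘F₁ ∈ Aut₂(R)`, where `gcd(a, b) = 1`, `C(0) = D(0) = 0` and `a`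
divides every coefficient of `D`, the elements `P` and `Q` of `K[X,Y]` have all of
their coefficients in `R` and `F = (X + aP, Y + Q)`. -/
theorem stmt_7 {R : Type*} [CommRing R] [IsDomain R] [UniqueFactorizationMonoid R]
    (a b : R) (ha : a ≠ 0) (hb : b ≠ 0)
    (hab : ∀ d : R, d ∣ a → d ∣ b → IsUnit d)
    (C : Polynomial R) (D : Polynomial R)
    (hC0 : Polynomial.eval 0 C = 0) (hD0 : Polynomial.eval 0 D = 0)
    (haD : ∀ k : ℕ, a ∣ D.coeff k)
    (hF : MemAut2 R
      (pcomp
        (elemG (-(Polynomial.C ((algebraMap R (FractionRing R)) b)⁻¹ *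
          (D.map (algebraMap R (FractionRing R))).comp
            (Polynomial.C ((algebraMap R (FractionRing R)) a) * Polynomial.X))))
        (pcomp
          (elemF (-(Polynomial.C ((algebraMap R (FractionRing R)) a)⁻¹ *
            (C.map (algebraMap R (FractionRing R))).comp
              (Polynomial.C ((algebraMap R (FractionRing R)) b) * Polynomial.X))))
          (pcomp
            (elemG (Polynomial.C ((algebraMap R (FractionRing R)) b)⁻¹ *
              (D.map (algebraMap R (FractionRing R))).comp
                (Polynomial.C ((algebraMap R (FractionRing R)) a) * Polynomial.X)))
            (elemF (Polynomial.C ((algebraMap R (FractionRing R)) a)⁻¹ *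
              (C.map (algebraMap R (FractionRing R))).comp
                (Polynomial.C ((algebraMap R (FractionRing R)) b) * Polynomial.X))))))) :
    CoeffsIn R (Pexpr a b C D) ∧ CoeffsIn R (Qexpr a b C D) ∧
    (pcomp
        (elemG (-(Polynomial.C ((algebraMap R (FractionRing R)) b)⁻¹ *
          (D.map (algebraMap R (FractionRing R))).comp
            (Polynomial.C ((algebraMap R (FractionRing R)) a) * Polynomial.X))))
        (pcomp
          (elemF (-(Polynomial.C ((algebraMap R (FractionRing R)) a)⁻¹ *
            (C.map (algebraMap R (FractionRing R))).comp
              (Polynomial.C ((algebraMap R (FractionRing R)) b) * Polynomial.X))))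
          (pcomp
            (elemG (Polynomial.C ((algebraMap R (FractionRing R)) b)⁻¹ *
              (D.map (algebraMap R (FractionRing R))).comp
                (Polynomial.C ((algebraMap R (FractionRing R)) a) * Polynomial.X)))
            (elemF (Polynomial.C ((algebraMap R (FractionRing R)) a)⁻¹ *
              (C.map (algebraMap R (FractionRing R))).comp
                (Polynomial.C ((algebraMap R (FractionRing R)) b) * Polynomial.X)))))) =
      (MvPolynomial.X 0 + MvPolynomial.C ((algebraMap R (FractionRing R)) a) * Pexpr a b C D,
       MvPolynomial.X 1 + Qexpr a b C D) := by
  rw [commutator_eq_add_Pexpr_Qexpr ha hb] at hF ⊢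
  obtain ⟨h₁, h₂, -⟩ := hF
  have hX (i : Fin 2) : CoeffsIn R (MvPolynomial.X i : MvPolynomial (Fin 2) (FractionRing R)) := by
    simpa using coeffsIn_map (K := FractionRing R) (MvPolynomial.X i : MvPolynomial (Fin 2) R)
  exact ⟨coeffsIn_of_relPrime_mul ha (fun d => hab d) (coeffsIn_of_add_left (hX 0) h₁)
    (coeffsIn_C_mul_Pexpr_of_dvd_coeff ha hb C D haD), coeffsIn_of_add_left (hX 1) h₂, rfl⟩

end
end

section
/- Let R be an integral domain with field of fractions K, and let F ∈ Aut₂(R). Then there exist an integer m ≥ 0, elements c, d ∈ R, a unit a of R, and polynomial maps F₁,…,F_m over K, each of the form (X, Y + f(X)) or (X + g(Y), Y) with f, g ∈ K[X], such that F = L∘D_{a,1}∘F_m∘F_{m−1}∘⋯∘F₁ as polynomial maps over K (F₁ applied first), where L = (X + c, Y + d) and D_{a,1} = (aX, Y). -/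
section TameAutomorphisms

open MvPolynomial

section WeightBound

variable {σ τ k : Type*} [CommRing k]

/-- Every monomial of `f` has `w`-weight at most `d`. -/
def WeightLE (w : σ → ℚ) (d : ℚ) (f : MvPolynomial σ k) : Prop :=
  ∀ m, coeff m f ≠ 0 → Finsupp.weight w m ≤ d

theorem WeightLE.mul {w : σ → ℚ} {d e : ℚ} {f g : MvPolynomial σ k} (hf : WeightLE w d f)
    (hg : WeightLE w e g) : WeightLE w (d + e) (f * g) := by
  classical
  intro m hm
  rw [coeff_mul] at hm
  obtain ⟨x, hx, hne⟩ := Finset.exists_ne_zero_of_sum_ne_zero hm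
  rw [Finset.HasAntidiagonal.mem_antidiagonal] at hx
  rw [← hx, map_add]
  exact add_le_add (hf _ (left_ne_zero_of_mul hne)) (hg _ (right_ne_zero_of_mul hne))

theorem weightLE_one (w : σ → ℚ) : WeightLE w 0 (1 : MvPolynomial σ k) := by
  classical
  intro m hm
  rw [coeff_one] at hm
  by_cases h : 0 = m
  · simp [← h]
  · simp [h] at hm

theorem weightedHomogeneousComponent_mul_of_weightLE {w : σ → ℚ} {d e : ℚ}
    {f g : MvPolynomial σ k} (hf : WeightLE w d f) (hg : WeightLE w e g) :
    weightedHomogeneousComponent w (d + e) (f * g) =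
      weightedHomogeneousComponent w d f * weightedHomogeneousComponent w e g := by
  classical
  ext m
  rw [coeff_weightedHomogeneousComponent, coeff_mul, coeff_mul]
  simp only [coeff_weightedHomogeneousComponent]
  split_ifs with hm
  · refine Finset.sum_congr rfl fun x hx => ?_
    rw [Finset.HasAntidiagonal.mem_antidiagonal] at hx
    rw [← hx, map_add] at hm
    by_cases h1 : coeff x.1 f = 0
    · simp [h1]
    by_cases h2 : coeff x.2 g = 0
    · simp [h2]
    have h3 := hf _ h1
    have h4 := hg _ h2
    rw [if_pos (by linarith), if_pos (by linarith)]
  · symm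
    refine Finset.sum_eq_zero fun x hx => ?_
    rw [Finset.HasAntidiagonal.mem_antidiagonal] at hx
    rw [← hx, map_add] at hm
    split_ifs with h1 h2
    · exact absurd (by rw [h1, h2]) hm
    all_goals simp

theorem weightLE_monomial {w : σ → ℚ} (m : σ →₀ ℕ) (c : k) :
    WeightLE w (Finsupp.weight w m) (monomial m c) := by
  classical
  intro n hn
  rw [coeff_monomial] at hn
  by_cases h : m = n
  · rw [h]
  · simp [h] at hn

theorem weightLE_pow_and_component {w : σ → ℚ} {d : ℚ} {f : MvPolynomial σ k}
    (hf : WeightLE w d f) (n : ℕ) :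
    WeightLE w (n * d) (f ^ n) ∧
      weightedHomogeneousComponent w (n * d) (f ^ n) =
        weightedHomogeneousComponent w d f ^ n := by
  induction n with
  | zero =>
    simpa using ⟨weightLE_one w, (isWeightedHomogeneous_one k w).weightedHomogeneousComponent_same⟩
  | succ n ih =>
    have h : ((n + 1 : ℕ) : ℚ) * d = n * d + d := by push_cast; ring
    rw [h, pow_succ, pow_succ]
    exact ⟨ih.1.mul hf, by rw [weightedHomogeneousComponent_mul_of_weightLE ih.1 hf, ih.2]⟩

theorem weightLE_finsuppProd_and_component {w : σ → ℚ} {v : τ → ℚ} {x : σ → MvPolynomial τ k}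
    (hx : ∀ i, WeightLE v (w i) (x i)) (m : σ →₀ ℕ) :
    WeightLE v (Finsupp.weight w m) (m.prod fun i n => x i ^ n) ∧
      weightedHomogeneousComponent v (Finsupp.weight w m) (m.prod fun i n => x i ^ n) =
        m.prod fun i n => weightedHomogeneousComponent v (w i) (x i) ^ n := by
  classical
  induction m using Finsupp.induction_linear with
  | zero =>
    simpa using ⟨weightLE_one v, (isWeightedHomogeneous_one k v).weightedHomogeneousComponent_same⟩
  | add f g hf hg =>
    rw [Finsupp.prod_add_index' (by simp) (by intros; rw [pow_add]),
      Finsupp.prod_add_index' (by simp) (by intros; rw [pow_add]), map_add]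
    exact ⟨hf.1.mul hg.1, by
      rw [weightedHomogeneousComponent_mul_of_weightLE hf.1 hg.1, hf.2, hg.2]⟩
  | single i n =>
    rw [Finsupp.prod_single_index (by simp), Finsupp.prod_single_index (by simp),
      Finsupp.weight_single, nsmul_eq_mul]
    exact weightLE_pow_and_component (hx i) n

theorem weightLE_aeval_and_component {w : σ → ℚ} {v : τ → ℚ} {x : σ → MvPolynomial τ k}
    (hx : ∀ i, WeightLE v (w i) (x i)) {D : ℚ} {p : MvPolynomial σ k} (hp : WeightLE w D p) :
    WeightLE v D (aeval x p) ∧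
      weightedHomogeneousComponent v D (aeval x p) =
        aeval (fun i => weightedHomogeneousComponent v (w i) (x i))
          (weightedHomogeneousComponent w D p) := by
  classical
  have key : ∀ m ∈ p.support, WeightLE v D (aeval x (monomial m (coeff m p))) ∧
      weightedHomogeneousComponent v D (aeval x (monomial m (coeff m p))) =
        aeval (fun i => weightedHomogeneousComponent v (w i) (x i))
          (weightedHomogeneousComponent w D (monomial m (coeff m p))) := by
    intro m hm
    have hm' := hp m (mem_support_iff.mp hm)
    obtain ⟨h1, h2⟩ := weightLE_finsuppProd_and_component hx m
    rw [aeval_monomial, algebraMap_eq]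
    refine ⟨?_, ?_⟩
    · intro n hn
      rw [coeff_C_mul] at hn
      exact (h1 n (right_ne_zero_of_mul hn)).trans hm'
    · rw [weightedHomogeneousComponent_C_mul]
      rcases hm'.eq_or_lt with h | h
      · rw [← h, h2, (isWeightedHomogeneous_monomial w m _ rfl).weightedHomogeneousComponent_same,
          aeval_monomial, algebraMap_eq]
      · rw [(isWeightedHomogeneous_monomial w m _ rfl).weightedHomogeneousComponent_ne D h.ne',
          map_zero]
        convert mul_zero _
        ext n
        rw [coeff_weightedHomogeneousComponent, coeff_zero]
        split_ifs with hn
        · by_contra hne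
          exact absurd (h1 n hne) (by rw [hn]; exact not_le.mpr h)
        · rfl
  constructor
  · rw [p.as_sum, map_sum]
    intro n hn
    rw [coeff_sum] at hn
    obtain ⟨m, hm, hne⟩ := Finset.exists_ne_zero_of_sum_ne_zero hn
    exact (key m hm).1 n hne
  · conv_lhs => rw [p.as_sum]
    conv_rhs => rw [p.as_sum]
    simp only [map_sum]
    exact Finset.sum_congr rfl fun m hm => (key m hm).2

end WeightBound

section DegreeOf

variable {σ k : Type*} [Field k] {i : σ}

theorem degreeOf_eq_zero_of_mul_ne_zero {f g : MvPolynomial σ k} (h : f * g ≠ 0)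
    (hd : degreeOf i (f * g) = 0) : degreeOf i f = 0 := by
  rw [degreeOf_mul_eq (left_ne_zero_of_mul h) (right_ne_zero_of_mul h)] at hd
  omega

theorem degreeOf_pderiv_le (j : σ) (f : MvPolynomial σ k) :
    degreeOf i (pderiv j f) ≤ degreeOf i f := by
  rw [degreeOf_le_iff]
  intro m hm
  rw [mem_support_iff, coeff_pderiv] at hm
  have := monomial_le_degreeOf i (mem_support_iff.mpr (left_ne_zero_of_mul hm))
  simp only [Finsupp.add_apply] at this
  omega

theorem degreeOf_sub_eq_zero {f g : MvPolynomial σ k} (hf : degreeOf i f = 0)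
    (hg : degreeOf i g = 0) : degreeOf i (f - g) = 0 := by
  have := degreeOf_sub_le i f g
  omega

theorem degreeOf_eq_of_sub_C_mul {u v : MvPolynomial σ k} {c : k} (hc : c ≠ 0)
    (h : degreeOf i (u - C c * v) = 0) : degreeOf i u = degreeOf i v := by
  have h2 := degreeOf_add_le i (u - C c * v) (C c * v)
  have h3 := degreeOf_sub_le i u (u - C c * v)
  have h4 : degreeOf i (C c * v) = degreeOf i v :=
    degreeOf_C_mul i c (mem_nonZeroDivisors_of_ne_zero hc)
  rw [sub_add_cancel] at h2
  rw [sub_sub_cancel] at h3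
  omega

theorem degreeOf_pow_eq' (f : MvPolynomial σ k) (n : ℕ) (hn : n ≠ 0) :
    degreeOf i (f ^ n) = n * degreeOf i f := by
  rcases eq_or_ne f 0 with rfl | hf
  · simp [hn]
  · exact degreeOf_pow_eq i f n hf

theorem eq_one_or_eq_one_of_coprime {r s e : ℕ} (hs : s ≠ 0) (hr : r ≠ 0) (h : s.Coprime r)
    (he : 0 < e) (hle : s * (r * e) ≤ s * e + r * e) : s = 1 ∨ r = 1 := by
  by_contra! hne
  have hs2 : 2 ≤ s := by omega
  have hr2 : 2 ≤ r := by omega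
  have hsr : s * r ≤ s + r := by
    refine Nat.le_of_mul_le_mul_right ?_ he
    linarith
  have : s = 2 := by nlinarith
  have : r = 2 := by nlinarith
  subst_vars
  simp at h

/-- If a curve `x ^ s = c y ^ r + h` over a field of functions is parametrised non-trivially by
a one-parameter deformation, then one of the coprime exponents is `1`. -/
theorem exponent_eq_one_of_degreeOf_eq_zero {x y : MvPolynomial σ k} {a b : σ}
    (hdet : pderiv a x * pderiv b y - pderiv b x * pderiv a y ≠ 0)
    (hxy : ¬ (degreeOf i x = 0 ∧ degreeOf i y = 0)) {s r : ℕ} (hs : s ≠ 0) (hr : r ≠ 0)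
    (hsr : s.Coprime r) {c : k} (hc : c ≠ 0) (h : degreeOf i (x ^ s - C c * y ^ r) = 0) :
    s = 1 ∨ r = 1 := by
  set H := x ^ s - C c * y ^ r with hH
  set J := pderiv a x * pderiv b y - pderiv b x * pderiv a y with hJ
  have hdeg : s * degreeOf i x = r * degreeOf i y := by
    rw [← degreeOf_pow_eq' _ _ hs, ← degreeOf_pow_eq' _ _ hr]
    exact degreeOf_eq_of_sub_C_mul hc h
  obtain ⟨e, hex⟩ : r ∣ degreeOf i x := hsr.symm.dvd_of_dvd_mul_left ⟨_, hdeg⟩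
  have hey : degreeOf i y = s * e := by
    refine Nat.eq_of_mul_eq_mul_left (Nat.pos_of_ne_zero hr) ?_
    rw [← hdeg, hex]; ring
  have he : 0 < e := by
    rcases Nat.eq_zero_or_pos e with rfl | he
    · exact absurd ⟨by simpa using hex, by simpa using hey⟩ hxy
    · exact he
  have hx0 : x ≠ 0 := by rintro rfl; simp [hr, he.ne'] at hex
  have hy0 : y ≠ 0 := by rintro rfl; simp [hs, he.ne'] at hey
  have hHd : ∀ j, degreeOf i (pderiv j H) = 0 := fun j => by
    have := degreeOf_pderiv_le (i := i) j H
    omega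
  have hpd : ∀ j, pderiv j H = (s : MvPolynomial σ k) * x ^ (s - 1) * pderiv j x
      - C c * ((r : MvPolynomial σ k) * y ^ (r - 1) * pderiv j y) := fun j => by
    rw [hH, map_sub, pderiv_C_mul, pderiv_pow, pderiv_pow]
  have hbound : ∀ z : MvPolynomial σ k,
      degreeOf i (pderiv a H * pderiv b z - pderiv b H * pderiv a z) ≤ degreeOf i z := by
    intro z
    have h1 := degreeOf_sub_le i (pderiv a H * pderiv b z) (pderiv b H * pderiv a z)
    have h2 := degreeOf_mul_le i (pderiv a H) (pderiv b z)
    have h3 := degreeOf_mul_le i (pderiv b H) (pderiv a z)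
    have h4 := degreeOf_pderiv_le (i := i) a z
    have h5 := degreeOf_pderiv_le (i := i) b z
    rw [hHd] at h2 h3
    omega
  have hlow : ∀ (z : MvPolynomial σ k) (n : ℕ) (d : k), z ≠ 0 → d ≠ 0 →
      n * degreeOf i z ≤ degreeOf i (C d * (z ^ n * J)) := by
    intro z n d hz hd
    rw [degreeOf_C_mul i d (mem_nonZeroDivisors_of_ne_zero hd),
      degreeOf_mul_eq (pow_ne_zero _ hz) hdet, degreeOf_pow_eq i z n hz]
    omega
  have hcast : ∀ n : ℕ, (n : MvPolynomial σ k) = C (n : k) := fun n => by simp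
  have hor : (s : k) ≠ 0 ∨ (r : k) ≠ 0 := by
    by_contra! hcon
    have h1 := (hsr.cast (R := k))
    rw [hcon.1, hcon.2] at h1
    obtain ⟨_, _, h1⟩ := h1
    simp at h1
  refine eq_one_or_eq_one_of_coprime hs hr hsr he ?_
  rcases hor with hk | hk
  · have h1 := hlow x (s - 1) s hx0 hk
    have h2 : C (s : k) * (x ^ (s - 1) * J) =
        pderiv a H * pderiv b y - pderiv b H * pderiv a y := by
      rw [hpd, hpd, hcast, hcast, hJ]; ring
    rw [h2] at h1
    have h3 := h1.trans (hbound y)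
    rw [hex, hey, Nat.sub_mul] at h3
    omega
  · have h1 := hlow y (r - 1) (c * r) hy0 (mul_ne_zero hc hk)
    have h2 : C (c * r : k) * (y ^ (r - 1) * J) =
        pderiv a H * pderiv b x - pderiv b H * pderiv a x := by
      rw [hpd, hpd, hcast, hcast, hJ, C_mul]; ring
    rw [h2] at h1
    have h3 := h1.trans (hbound x)
    rw [hex, hey, Nat.sub_mul, one_mul, ← mul_assoc, mul_comm r s] at h3
    rw [← mul_assoc]
    omega

/-- A binary form with constant (in the `i`-th variable) nonzero value at a non-constant pair is
a power of a linear form. -/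
theorem eq_C_mul_X_sub_C_pow_of_degreeOf_homogenize {f : Polynomial k} {u v : MvPolynomial σ k}
    (hf : f.natDegree ≠ 0) (hne : aeval ![u, v] (f.homogenize f.natDegree) ≠ 0)
    (hd : degreeOf i (aeval ![u, v] (f.homogenize f.natDegree)) = 0)
    (huv : ¬ (degreeOf i u = 0 ∧ degreeOf i v = 0)) :
    ∃ c : k, f = Polynomial.C f.leadingCoeff * (Polynomial.X - Polynomial.C c) ^ f.natDegree ∧
      degreeOf i (u - C c * v) = 0 := by
  let K := AlgebraicClosure k
  let φ : k →+* K := algebraMap k K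
  have hφ : Function.Injective φ := φ.injective
  have hmapd : ∀ g : MvPolynomial σ k, degreeOf i (map φ g) = degreeOf i g := fun g => by
    classical
    rw [degreeOf_def, degreeOf_def, degrees_map_of_injective _ hφ]
  set u' := map φ u
  set v' := map φ v
  have hmap : map φ (aeval ![u, v] (f.homogenize f.natDegree)) =
      aeval ![u', v'] ((f.map φ).homogenize f.natDegree) := by
    rw [Polynomial.homogenize_map, aeval_def, aeval_def, eval₂_map, hom_eval₂]
    congr 1
    · ext; simp
    · ext j; fin_cases j <;> rfl
  have hroot : ∀ c : K, (f.map φ).IsRoot c → degreeOf i (u' - C c * v') = 0 := by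
    intro c hc
    obtain ⟨q, hq⟩ := Polynomial.dvd_iff_isRoot.mpr hc
    have hq0 : q ≠ 0 := by
      rintro rfl
      rw [mul_zero, Polynomial.map_eq_zero] at hq
      simp [hq] at hf
    have hqd : 1 + q.natDegree = f.natDegree := by
      rw [← Polynomial.natDegree_map φ, hq, Polynomial.natDegree_mul (Polynomial.X_sub_C_ne_zero c)
        hq0, Polynomial.natDegree_X_sub_C]
    rw [hq, ← hqd, Polynomial.homogenize_mul _ _ (Polynomial.natDegree_X_sub_C_le c) le_rfl,
      map_mul, hqd] at hmap
    have hlin : aeval ![u', v'] ((Polynomial.X - Polynomial.C c).homogenize 1) = u' - C c * v' := by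
      rw [Polynomial.homogenize_sub, Polynomial.homogenize_X one_ne_zero, Polynomial.homogenize_C]
      simp [algebraMap_eq]
    rw [hlin] at hmap
    refine degreeOf_eq_zero_of_mul_ne_zero (i := i) (g := aeval ![u', v']
      (q.homogenize q.natDegree)) ?_ ?_
    · rw [← hmap]
      exact (map_ne_zero_iff _ (map_injective φ hφ)).mpr hne
    · rw [← hmap, hmapd, hd]
  have hsub : ∀ c : K, degreeOf i (u' - C c * v') = 0 → degreeOf i v' = 0 → False := by
    intro c hc hv
    have h1 := degreeOf_add_le i (u' - C c * v') (C c * v')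
    have h2 := degreeOf_C_mul_le v' i c
    rw [sub_add_cancel] at h1
    refine huv ⟨?_, ?_⟩
    · have h3 : degreeOf i u' = degreeOf i u := hmapd u
      omega
    · rw [← hmapd]
      exact hv
  obtain ⟨μ, hμ⟩ := IsAlgClosed.exists_root (f.map φ) (by
    rw [Polynomial.degree_map]
    exact fun h => hf (Polynomial.natDegree_eq_of_degree_eq_some h))
  have hμd := hroot μ hμ
  have huniq : ∀ ν, (f.map φ).IsRoot ν → ν = μ := by
    intro ν hν
    by_contra hne'
    have h1 := degreeOf_sub_eq_zero hμd (hroot ν hν)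
    have h2 : u' - C μ * v' - (u' - C ν * v') = C (ν - μ) * v' := by rw [C_sub]; ring
    rw [h2, degreeOf_C_mul i _ (mem_nonZeroDivisors_of_ne_zero (sub_ne_zero.mpr hne'))] at h1
    exact hsub μ hμd h1
  obtain ⟨c, rfl⟩ : ∃ c, φ c = μ := by
    have hv : degreeOf i v ≠ 0 := fun h => hsub μ hμd (by rw [hmapd, h])
    obtain ⟨m, hm, hmi⟩ : ∃ m ∈ v.support, m i ≠ 0 := by
      by_contra! hcon
      exact hv (Nat.le_zero.mp (degreeOf_le_iff.mpr fun m hm => (hcon m hm).le))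
    have hzero : coeff m (u' - C μ * v') = 0 := by
      by_contra hcon
      have := monomial_le_degreeOf i (mem_support_iff.mpr hcon)
      omega
    rw [coeff_sub, coeff_C_mul, coeff_map, coeff_map, sub_eq_zero] at hzero
    have hvm : φ (coeff m v) ≠ 0 := (map_ne_zero φ).mpr (mem_support_iff.mp hm)
    exact ⟨coeff m u / coeff m v, by rw [map_div₀, hzero, mul_div_cancel_right₀ _ hvm]⟩
  refine ⟨c, ?_, ?_⟩
  · apply Polynomial.map_injective φ hφ
    have hsp := IsAlgClosed.splits (f.map φ)
    have hrep : (f.map φ).roots = Multiset.replicate f.natDegree (φ c) := by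
      rw [Multiset.eq_replicate]
      refine ⟨by rw [← hsp.natDegree_eq_card_roots, Polynomial.natDegree_map], fun ν hν => ?_⟩
      exact huniq ν (Polynomial.isRoot_of_mem_roots hν)
    conv_lhs => rw [hsp.eq_prod_roots, hrep]
    simp
  · rw [← hmapd]
    simpa using hμd

end DegreeOf

section Deformation

variable {k : Type*} [Field k]

theorem degreeOf_aeval_eq_zero {σ τ : Type*} {i : τ} {x : σ → MvPolynomial τ k}
    (hx : ∀ j, degreeOf i (x j) = 0) (p : MvPolynomial σ k) : degreeOf i (aeval x p) = 0 := by
  induction p using MvPolynomial.induction_on with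
  | C c => simp [algebraMap_eq]
  | add p q hp hq =>
    rw [map_add]
    have := degreeOf_add_le i (aeval x p) (aeval x q)
    omega
  | mul_X p j hp =>
    rw [map_mul, aeval_X]
    have := degreeOf_mul_le i (aeval x p) (x j)
    have := hx j
    omega

theorem dvd_aeval_add_sub_aeval {R : Type*} [CommRing R] [Algebra k R] (x y t : R)
    (p : MvPolynomial (Fin 2) k) : t ∣ aeval ![x, y + t] p - aeval ![x, y] p := by
  rw [← Ideal.mem_span_singleton, ← Ideal.Quotient.mk_eq_mk_iff_sub_mem]
  have h : ∀ z : Fin 2 → R, Ideal.Quotient.mk (Ideal.span {t}) (aeval z p) =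
      aeval (fun j => Ideal.Quotient.mk (Ideal.span {t}) (z j)) p := fun z => by
    rw [← Ideal.Quotient.mkₐ_eq_mk k, ← AlgHom.comp_apply, comp_aeval]
  rw [h, h]
  congr 2
  ext j
  fin_cases j
  · rfl
  · have : Ideal.Quotient.mk (Ideal.span {t}) t = 0 :=
      Ideal.Quotient.eq_zero_iff_mem.mpr (Ideal.mem_span_singleton_self t)
    simp [this]

theorem coeff_eq_of_X_dvd_sub {σ : Type*} {i : σ} {f g : MvPolynomial σ k} (h : X i ∣ f - g)
    {m : σ →₀ ℕ} (hm : m i = 0) : coeff m f = coeff m g := by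
  classical
  obtain ⟨q, hq⟩ := h
  rw [← sub_eq_zero, ← coeff_sub, hq, coeff_X_mul']
  simp [hm]

theorem weight_fin_two (w : Fin 2 → ℚ) (m : Fin 2 →₀ ℕ) :
    Finsupp.weight w m = m 0 * w 0 + m 1 * w 1 := by
  simp [Finsupp.weight_eq_sum]

theorem weight_fin_three (w : Fin 3 → ℚ) (m : Fin 3 →₀ ℕ) :
    Finsupp.weight w m = m 0 * w 0 + m 1 * w 1 + m 2 * w 2 := by
  simp [Finsupp.weight_eq_sum, Fin.sum_univ_three]

theorem weightLE_X {σ : Type*} (w : σ → ℚ) (i : σ) :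
    WeightLE w (w i) (X i : MvPolynomial σ k) := by
  have h := weightLE_monomial (w := w) (Finsupp.single i 1) (1 : k)
  rwa [Finsupp.weight_single, one_smul] at h

theorem weightedHomogeneousComponent_X {σ : Type*} (w : σ → ℚ) (i : σ) :
    weightedHomogeneousComponent w (w i) (X i : MvPolynomial σ k) = X i :=
  (isWeightedHomogeneous_X k w i).weightedHomogeneousComponent_same

/-- A deformation `(x, y)` of `(X, Y)` with parameter `t = X 2` that is not trivial can be
weighted in `t` so that its leading forms still are a non-trivial deformation. -/
theorem exists_weight_of_deformation {x y : MvPolynomial (Fin 3) k} (hx : X 2 ∣ x - X 0)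
    (hy : X 2 ∣ y - X 1) (hxy : ¬ (degreeOf 2 x = 0 ∧ degreeOf 2 y = 0)) (w : Fin 2 → ℚ) :
    ∃ τ : ℚ, WeightLE ![w 0, w 1, τ] (w 0) x ∧ WeightLE ![w 0, w 1, τ] (w 1) y ∧
      ¬ (degreeOf 2 (weightedHomogeneousComponent ![w 0, w 1, τ] (w 0) x) = 0 ∧
        degreeOf 2 (weightedHomogeneousComponent ![w 0, w 1, τ] (w 1) y) = 0) := by
  classical
  let ρ : ℚ → (Fin 3 →₀ ℕ) → ℚ := fun d m => (d - (m 0 * w 0 + m 1 * w 1)) / m 2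
  let S : ℚ → MvPolynomial (Fin 3) k → Finset ℚ := fun d f =>
    (f.support.filter fun m => m 2 ≠ 0).image (ρ d)
  have hS : ∀ d f q, q ∈ S d f ↔ ∃ m, coeff m f ≠ 0 ∧ m 2 ≠ 0 ∧ ρ d m = q := by
    intro d f q
    simp [S, and_assoc]
  have hne : (S (w 0) x ∪ S (w 1) y).Nonempty := by
    have : ∀ d f, degreeOf 2 f ≠ 0 → (S d f).Nonempty := by
      intro d f hf
      by_contra hemp
      rw [Finset.not_nonempty_iff_eq_empty] at hemp
      refine hf (Nat.le_zero.mp (degreeOf_le_iff.mpr fun m hm => ?_))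
      by_contra hm2
      have : ρ d m ∈ S d f := (hS _ _ _).mpr ⟨m, mem_support_iff.mp hm, by omega, rfl⟩
      simp [hemp] at this
    rw [not_and_or] at hxy
    rcases hxy with h | h
    · exact (this _ _ h).mono Finset.subset_union_left
    · exact (this _ _ h).mono Finset.subset_union_right
  set τ := (S (w 0) x ∪ S (w 1) y).min' hne with hτ
  have hweight : ∀ m : Fin 3 →₀ ℕ, Finsupp.weight ![w 0, w 1, τ] m =
      m 0 * w 0 + m 1 * w 1 + m 2 * τ := fun m => by
    rw [weight_fin_three]; rfl
  have hle : ∀ (d : ℚ) (f : MvPolynomial (Fin 3) k) (j : Fin 3), X 2 ∣ f - X j →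
      d = ![w 0, w 1, τ] j → S d f ⊆ S (w 0) x ∪ S (w 1) y → WeightLE ![w 0, w 1, τ] d f := by
    intro d f j hf hd hsub m hm
    by_cases hm2 : m 2 = 0
    · rw [coeff_eq_of_X_dvd_sub hf hm2] at hm
      rw [hd]
      exact weightLE_X _ _ m hm
    · have hmem := hsub ((hS _ _ _).mpr ⟨m, hm, hm2, rfl⟩)
      have h1 : τ ≤ ρ d m := Finset.min'_le _ _ hmem
      have hpos : (0 : ℚ) < m 2 := by exact_mod_cast Nat.pos_of_ne_zero hm2
      rw [hweight]
      have h2 := (le_div_iff₀ hpos).mp h1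
      linarith
  have hattain : ∀ (d : ℚ) (f : MvPolynomial (Fin 3) k), τ ∈ S d f →
      degreeOf 2 (weightedHomogeneousComponent ![w 0, w 1, τ] d f) ≠ 0 := by
    intro d f hmem hzero
    obtain ⟨m, hm, hm2, hρ⟩ := (hS _ _ _).mp hmem
    have hpos : (0 : ℚ) < m 2 := by exact_mod_cast Nat.pos_of_ne_zero hm2
    have hw : Finsupp.weight ![w 0, w 1, τ] m = d := by
      rw [hweight]
      have := (div_eq_iff hpos.ne').mp hρ
      linarith
    have hc : coeff m (weightedHomogeneousComponent ![w 0, w 1, τ] d f) ≠ 0 := by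
      rwa [coeff_weightedHomogeneousComponent, if_pos hw]
    have := monomial_le_degreeOf 2 (mem_support_iff.mpr hc)
    omega
  refine ⟨τ, hle _ _ 0 hx rfl Finset.subset_union_left, hle _ _ 1 hy rfl Finset.subset_union_right,
    fun h => ?_⟩
  rcases Finset.mem_union.mp (Finset.min'_mem _ hne) with hmem | hmem
  · exact hattain _ _ hmem h.1
  · exact hattain _ _ hmem h.2

/-- The leading forms of `F` are invariant under a non-trivial deformation of the plane. -/
theorem exists_deformation_of_leadingForm {F G : PolyPair k} (hFG : pcomp F G = idPair k)
    (hGF : pcomp G F = idPair k) (w : Fin 2 → ℚ) :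
    ∃ x y : MvPolynomial (Fin 3) k,
      pderiv 0 x * pderiv 1 y - pderiv 1 x * pderiv 0 y ≠ 0 ∧
      ¬ (degreeOf 2 x = 0 ∧ degreeOf 2 y = 0) ∧
      ∀ D, WeightLE w D F.1 →
        aeval ![x, y] (weightedHomogeneousComponent w D F.1) =
          rename Fin.castSucc (weightedHomogeneousComponent w D F.1) := by
  classical
  obtain ⟨P, Q⟩ := F
  obtain ⟨U, V⟩ := G
  simp only [pcomp, idPair, Prod.mk.injEq] at hFG hGF
  let j : MvPolynomial (Fin 2) k →ₐ[k] MvPolynomial (Fin 3) k := rename Fin.castSucc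
  have hj : ∀ p, j p = aeval ![X 0, X 1] p := fun p => by
    refine DFunLike.congr_fun (algHom_ext fun i => ?_) p
    fin_cases i <;> simp [j]
  have hjd : ∀ p, degreeOf 2 (j p) = 0 := fun p => by
    rw [hj]
    refine degreeOf_aeval_eq_zero (fun i => ?_) p
    fin_cases i <;> simp [degreeOf_X]
  have hcomp : ∀ A B : MvPolynomial (Fin 3) k, ∀ p q r : MvPolynomial (Fin 2) k,
      aeval ![aeval ![A, B] p, aeval ![A, B] q] r = aeval ![A, B] (aeval ![p, q] r) := by
    intro A B p q r
    rw [← AlgHom.comp_apply (aeval ![A, B]), comp_aeval]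
    congr 2
    ext i
    fin_cases i <;> rfl
  set x := aeval ![j P, j Q + X 2] U with hxdef
  set y := aeval ![j P, j Q + X 2] V with hydef
  have hxP : aeval ![x, y] P = j P := by rw [hxdef, hydef, hcomp, hFG.1]; simp
  have hxQ : aeval ![x, y] Q = j Q + X 2 := by rw [hxdef, hydef, hcomp, hFG.2]; simp
  have hx : X 2 ∣ x - X 0 := by
    have h := dvd_aeval_add_sub_aeval (j P) (j Q) (X 2) U
    rwa [hj P, hj Q, hcomp, hGF.1, aeval_X, ← hj, ← hj] at h
  have hy : X 2 ∣ y - X 1 := by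
    have h := dvd_aeval_add_sub_aeval (j P) (j Q) (X 2) V
    rwa [hj P, hj Q, hcomp, hGF.2, aeval_X, ← hj, ← hj] at h
  have hxy : ¬ (degreeOf 2 x = 0 ∧ degreeOf 2 y = 0) := by
    rintro ⟨h1, h2⟩
    have h3 : degreeOf 2 (aeval ![x, y] Q) = 0 := by
      refine degreeOf_aeval_eq_zero (fun i => ?_) Q
      fin_cases i
      · exact h1
      · exact h2
    have h4 := degreeOf_sub_eq_zero h3 (hjd Q)
    rw [hxQ, add_sub_cancel_left] at h4
    simp at h4
  obtain ⟨τ, hτx, hτy, hτ⟩ := exists_weight_of_deformation hx hy hxy w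
  set v := ![w 0, w 1, τ] with hv
  have hlead : ∀ {z : MvPolynomial (Fin 3) k} {i : Fin 3} (l : Fin 3) (d : ℚ), X 2 ∣ z - X i →
      l ≠ 2 → d = v i → constantCoeff (pderiv l (weightedHomogeneousComponent v d z)) =
        if i = l then 1 else 0 := by
    rintro z i l _ hz hl rfl
    rw [constantCoeff_eq, coeff_pderiv, zero_add]
    simp only [Finsupp.coe_zero, Pi.zero_apply, Nat.cast_zero, zero_add, mul_one]
    rw [coeff_weightedHomogeneousComponent,
      coeff_eq_of_X_dvd_sub hz (Finsupp.single_eq_of_ne hl.symm), Finsupp.weight_single, one_smul,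
      coeff_X]
    by_cases hil : i = l
    · simp [hil]
    · have : Finsupp.single i 1 ≠ Finsupp.single l 1 := fun h =>
        hil (Finsupp.single_left_injective one_ne_zero h)
      rw [if_neg hil, if_neg this, ite_self]
  refine ⟨weightedHomogeneousComponent v (w 0) x, weightedHomogeneousComponent v (w 1) y,
    fun h => ?_, hτ, fun D hD => ?_⟩
  · have h' := congrArg constantCoeff h
    rw [map_sub, map_mul, map_mul, hlead (i := 0) 0 (w 0) hx (by decide) rfl,
      hlead (i := 1) 1 (w 1) hy (by decide) rfl, hlead (i := 0) 1 (w 0) hx (by decide) rfl,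
      hlead (i := 1) 0 (w 1) hy (by decide) rfl] at h'
    simp at h'
  · have h1 := (weightLE_aeval_and_component (v := v) (x := ![x, y]) (fun i => by
      fin_cases i
      · exact hτx
      · exact hτy) hD).2
    have h2 := (weightLE_aeval_and_component (w := w) (v := v) (x := ![X 0, X 1]) (fun i => by
      fin_cases i
      · exact weightLE_X v 0
      · exact weightLE_X v 1) hD).2
    rw [hxP, hj, h2] at h1
    refine Eq.trans ?_ (h1.symm.trans ?_)
    · congr 2
      ext i
      fin_cases i <;> rfl
    · change _ = j _
      rw [hj]
      congr 2
      funext i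
      fin_cases i
      · exact weightedHomogeneousComponent_X v 0
      · exact weightedHomogeneousComponent_X v 1

end Deformation

section LeadingForm

variable {k : Type*} [Field k]

theorem exists_weightLE_and_component_ne_zero {σ : Type*} (w : σ → ℚ) {p : MvPolynomial σ k}
    (hp : p ≠ 0) : ∃ D, WeightLE w D p ∧ weightedHomogeneousComponent w D p ≠ 0 := by
  classical
  obtain ⟨m, hm, hmax⟩ := p.support.exists_max_image (Finsupp.weight w)
    (support_nonempty.mpr hp)
  refine ⟨Finsupp.weight w m, fun n hn => hmax n (mem_support_iff.mpr hn), fun h => ?_⟩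
  have := congrArg (coeff m) h
  rw [coeff_weightedHomogeneousComponent, if_pos rfl, coeff_zero] at this
  exact mem_support_iff.mp hm this

theorem exists_eq_aeval_homogenize {p : MvPolynomial (Fin 2) k} {s r g : ℕ} (hs : s ≠ 0)
    (hr : r ≠ 0) (hsr : s.Coprime r)
    (hp : ∀ m, coeff m p ≠ 0 → m 0 * r + m 1 * s = g * (s * r)) :
    ∃ f : Polynomial k, f.natDegree ≤ g ∧ f.coeff 0 = coeff (Finsupp.single 1 (g * r)) p ∧
      f.coeff g = coeff (Finsupp.single 0 (g * s)) p ∧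
      aeval ![X 0 ^ s, X 1 ^ r] (f.homogenize g) = p := by
  classical
  let e : ℕ → ℕ → (Fin 2 →₀ ℕ) := fun n l => Finsupp.single 0 (n * s) + Finsupp.single 1 (l * r)
  have he0 : ∀ n l, e n l 0 = n * s := fun n l => by simp [e]
  have he1 : ∀ n l, e n l 1 = l * r := fun n l => by simp [e]
  let f : Polynomial k := ∑ n ∈ Finset.range (g + 1), Polynomial.monomial n (coeff (e n (g - n)) p)
  have hf : ∀ n ≤ g, f.coeff n = coeff (e n (g - n)) p := by
    intro n hn
    have : n < g + 1 := by omega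
    simp [f, Polynomial.coeff_monomial, this]
  refine ⟨f, ?_, ?_, ?_, ?_⟩
  · refine Polynomial.natDegree_sum_le_of_forall_le _ _ fun n hn => ?_
    have := Finset.mem_range.mp hn
    exact (Polynomial.natDegree_monomial_le _).trans (by omega)
  · rw [hf 0 (Nat.zero_le _)]; simp [e]
  · rw [hf g le_rfl]; simp [e]
  · have hsum : aeval ![X 0 ^ s, X 1 ^ r] (f.homogenize g) =
        ∑ kl ∈ Finset.HasAntidiagonal.antidiagonal g, monomial (e kl.1 kl.2) (coeff (e kl.1 kl.2) p) := by
      rw [Polynomial.homogenize, map_sum]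
      refine Finset.sum_congr rfl fun kl hkl => ?_
      have hkl' := Finset.HasAntidiagonal.mem_antidiagonal.mp hkl
      rw [hf kl.1 (by omega), show g - kl.1 = kl.2 by omega, aeval_monomial,
        Finsupp.prod_fintype _ _ (by simp)]
      simp only [Fin.prod_univ_two, e]
      rw [algebraMap_eq, ← mul_one (coeff _ p), ← C_mul_monomial, ← mul_one (1 : k),
        ← monomial_mul]
      simp [X_pow_eq_monomial, monomial_pow, mul_comm]
    rw [hsum]
    ext m
    rw [coeff_sum]
    simp only [coeff_monomial]
    by_cases hm : coeff m p = 0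
    · rw [hm]
      refine Finset.sum_eq_zero fun kl _ => ?_
      split_ifs with h
      · rw [h, hm]
      · rfl
    · have hw := hp m hm
      have hd0 : s ∣ m 0 := by
        refine hsr.dvd_of_dvd_mul_right ((Nat.dvd_add_iff_left (dvd_mul_left s (m 1))).mpr ?_)
        rw [hw]
        exact (dvd_mul_right s r).mul_left g
      obtain ⟨n, hn⟩ := hd0
      have hd1 : r ∣ m 1 := by
        refine hsr.symm.dvd_of_dvd_mul_right
          ((Nat.dvd_add_iff_right (dvd_mul_left r (m 0))).mpr ?_)
        rw [hw]
        exact (dvd_mul_left r s).mul_left g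
      obtain ⟨l, hl⟩ := hd1
      have hnl : n + l = g := by
        have : (n + l) * (s * r) = g * (s * r) := by rw [← hw, hn, hl]; ring
        exact Nat.eq_of_mul_eq_mul_right (by positivity) this
      have hem : ∀ a b, e a b = m ↔ (a, b) = (n, l) := by
        intro a b
        constructor
        · intro h
          have h0 := DFunLike.congr_fun h 0
          have h1 := DFunLike.congr_fun h 1
          rw [he0, hn, mul_comm] at h0
          rw [he1, hl, mul_comm] at h1
          rw [Nat.eq_of_mul_eq_mul_left (Nat.pos_of_ne_zero hs) h0,
            Nat.eq_of_mul_eq_mul_left (Nat.pos_of_ne_zero hr) h1]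
        · rintro h
          obtain ⟨rfl, rfl⟩ := Prod.mk.inj h
          ext i
          fin_cases i
          · exact (he0 a b).trans (by rw [mul_comm]; exact hn.symm)
          · exact (he1 a b).trans (by rw [mul_comm]; exact hl.symm)
      rw [Finset.sum_eq_single (n, l)]
      · rw [if_pos ((hem _ _).mpr rfl), (hem _ _).mpr rfl]
      · intro kl _ hne
        rw [if_neg]
        rwa [hem]
      · intro h
        exact absurd (Finset.HasAntidiagonal.mem_antidiagonal.mpr hnl) h

theorem aeval_homogenize_C_mul_X_sub_C_pow {A : Type*} [CommRing A] [Algebra k A] (u v : A)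
    (L c : k) (g : ℕ) :
    aeval ![u, v] ((Polynomial.C L * (Polynomial.X - Polynomial.C c) ^ g).homogenize g) =
      algebraMap k A L * (u - algebraMap k A c * v) ^ g := by
  rw [Polynomial.homogenize_C_mul, map_mul, aeval_C]
  congr 1
  induction g with
  | zero => simp
  | succ g ih =>
    rw [pow_succ, Polynomial.homogenize_mul, map_mul, ih, pow_succ]
    · simp
    · exact (Polynomial.natDegree_pow_le_of_le g (Polynomial.natDegree_X_sub_C_le c)).trans
        (by simp)
    · exact Polynomial.natDegree_X_sub_C_le c

end LeadingForm

section Reduction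

variable {k : Type*} [Field k]

theorem X_dvd_of_coeff {σ : Type*} {i : σ} {p : MvPolynomial σ k}
    (h : ∀ m, coeff m p ≠ 0 → m i ≠ 0) : X i ∣ p := by
  rw [p.as_sum]
  refine Finset.dvd_sum fun m hm => ?_
  exact X_dvd_monomial.mpr (Or.inr (h m (mem_support_iff.mp hm)))

theorem exists_coeff_ne_zero_of_degreeOf {σ : Type*} (i : σ) {p : MvPolynomial σ k} (hp : p ≠ 0) :
    ∃ m, coeff m p ≠ 0 ∧ m i = degreeOf i p := by
  obtain ⟨m, hm, h⟩ := Finset.exists_mem_eq_sup p.support (support_nonempty.mpr hp) fun m => m i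
  exact ⟨m, mem_support_iff.mp hm, by rw [degreeOf_eq_sup, h]⟩

theorem exists_leadingForm_eq {F G : PolyPair k} (hFG : pcomp F G = idPair k)
    (hGF : pcomp G F = idPair k) (h0 : degreeOf 0 F.1 ≠ 0) (h1 : degreeOf 1 F.1 ≠ 0) :
    ∃ (s r g : ℕ) (L c : k), degreeOf 0 F.1 = g * s ∧ degreeOf 1 F.1 = g * r ∧
      (s = 1 ∨ r = 1) ∧ c ≠ 0 ∧ WeightLE ![(r : ℚ), s] (g * (s * r)) F.1 ∧
      weightedHomogeneousComponent ![(r : ℚ), s] (g * (s * r)) F.1 =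
        C L * (X 0 ^ s - C c * X 1 ^ r) ^ g := by
  classical
  obtain ⟨s, r, hsr, has, hbr⟩ := Nat.exists_coprime (degreeOf 0 F.1) (degreeOf 1 F.1)
  set g := (degreeOf 0 F.1).gcd (degreeOf 1 F.1) with hg
  rw [mul_comm] at has hbr
  have hg0 : g ≠ 0 := fun h => h0 (by rw [has, h, zero_mul])
  have hs : s ≠ 0 := fun h => h0 (by rw [has, h, mul_zero])
  have hr : r ≠ 0 := fun h => h1 (by rw [hbr, h, mul_zero])
  have hP : F.1 ≠ 0 := fun h => h0 (by rw [h, degreeOf_zero])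
  obtain ⟨x, y, hdet, hxy, hinv⟩ := exists_deformation_of_leadingForm hFG hGF ![(r : ℚ), s]
  obtain ⟨D, hD, hne⟩ := exists_weightLE_and_component_ne_zero ![(r : ℚ), s] hP
  have hw : ∀ m, Finsupp.weight ![(r : ℚ), s] m = ((m 0 * r + m 1 * s : ℕ) : ℚ) := fun m => by
    rw [weight_fin_two]; push_cast; rfl
  set p := weightedHomogeneousComponent ![(r : ℚ), s] D F.1 with hp
  have hcp : ∀ m, coeff m p = if ((m 0 * r + m 1 * s : ℕ) : ℚ) = D then coeff m F.1 else 0 :=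
    fun m => by rw [hp, coeff_weightedHomogeneousComponent, hw]
  have hren : aeval ![x, y] p ≠ 0 := by
    rw [hinv D hD, Ne, rename_eq_zero_iff_of_injective _ (Fin.castSucc_injective 2)]
    exact hne
  have hdeg : degreeOf 2 (aeval ![x, y] p) = 0 := by
    have h : rename Fin.castSucc p =
        aeval (fun i : Fin 2 => (X i.castSucc : MvPolynomial (Fin 3) k)) p :=
      DFunLike.congr_fun (algHom_ext fun i => by simp) p
    rw [hinv D hD, ← hp, h]
    exact degreeOf_aeval_eq_zero (fun i => by fin_cases i <;> simp [degreeOf_X]) p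
  have hpure : ∃ m, coeff m p ≠ 0 ∧ (m 0 = 0 ∨ m 1 = 0) := by
    by_contra! hcon
    have hX : ∀ i : Fin 2, X i ∣ p → degreeOf 2 (![x, y] i) = 0 := by
      rintro i ⟨q, hq⟩
      have h : ![x, y] i * aeval ![x, y] q = aeval ![x, y] p := by rw [hq, map_mul, aeval_X]
      exact degreeOf_eq_zero_of_mul_ne_zero (h ▸ hren) (h ▸ hdeg)
    exact hxy ⟨hX 0 (X_dvd_of_coeff fun m hm => (hcon m hm).1),
      hX 1 (X_dvd_of_coeff fun m hm => (hcon m hm).2)⟩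
  have hsupp : ∀ m, coeff m F.1 ≠ 0 → m 0 ≤ g * s ∧ m 1 ≤ g * r := fun m hm => by
    rw [← has, ← hbr]
    exact ⟨monomial_le_degreeOf 0 (mem_support_iff.mpr hm),
      monomial_le_degreeOf 1 (mem_support_iff.mpr hm)⟩
  obtain ⟨m₀, hm₀, hm₀'⟩ := exists_coeff_ne_zero_of_degreeOf 0 hP
  obtain ⟨m₁, hm₁, hm₁'⟩ := exists_coeff_ne_zero_of_degreeOf 1 hP
  have hDeq : D = ((g * (s * r) : ℕ) : ℚ) := by
    refine le_antisymm ?_ ?_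
    · obtain ⟨m, hm, hm0⟩ := hpure
      rw [hcp] at hm
      have hmD := (ite_ne_right_iff.mp hm).1
      have hmF := hsupp m (ite_ne_right_iff.mp hm).2
      rw [← hmD, Nat.cast_le]
      rcases hm0 with h | h <;> rw [h]
      · nlinarith [Nat.mul_le_mul_right s hmF.2]
      · nlinarith [Nat.mul_le_mul_right r hmF.1]
    · have h := hD m₀ hm₀
      rw [hw, hm₀', has] at h
      refine le_trans ?_ h
      rw [Nat.cast_le]
      nlinarith
  have hle : ∀ m, coeff m F.1 ≠ 0 → m 0 * r + m 1 * s ≤ g * (s * r) := fun m hm => by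
    have := hD m hm
    rwa [hw, hDeq, Nat.cast_le] at this
  have hz0 : m₀ = Finsupp.single 0 (g * s) := by
    have h := hle m₀ hm₀
    rw [hm₀', has] at h
    have h' : m₀ 1 * s ≤ 0 := by nlinarith
    have h'' : m₀ 1 = 0 := by simpa [hs] using h'
    ext i
    fin_cases i
    · simpa [has] using hm₀'
    · simpa using h''
  have hz1 : m₁ = Finsupp.single 1 (g * r) := by
    have h := hle m₁ hm₁
    rw [hm₁', hbr] at h
    have h' : m₁ 0 * r ≤ 0 := by nlinarith
    have h'' : m₁ 0 = 0 := by simpa [hr] using h'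
    ext i
    fin_cases i
    · simpa using h''
    · simpa [hbr] using hm₁'
  obtain ⟨f, hfg, hf0, hfl, hfp⟩ := exists_eq_aeval_homogenize (p := p) (g := g) hs hr hsr (by
    intro m hm
    rw [hcp, hDeq] at hm
    exact_mod_cast (ite_ne_right_iff.mp hm).1)
  have hf0' : f.coeff 0 ≠ 0 := by
    rw [hf0, ← hz1, hcp, if_pos]
    · exact hm₁
    · rw [hDeq, hz1]; norm_num; ring
  have hfl' : f.coeff g ≠ 0 := by
    rw [hfl, ← hz0, hcp, if_pos]
    · exact hm₀
    · rw [hDeq, hz0]; norm_num; ring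
  have hfd : f.natDegree = g := le_antisymm hfg (Polynomial.le_natDegree_of_ne_zero hfl')
  have hsub : aeval ![x ^ s, y ^ r] (f.homogenize g) = aeval ![x, y] p := by
    rw [← hfp, ← AlgHom.comp_apply, comp_aeval]
    congr 2
    ext1 i
    fin_cases i <;> simp
  obtain ⟨c, hfc, hc⟩ := eq_C_mul_X_sub_C_pow_of_degreeOf_homogenize (f := f) (u := x ^ s)
    (v := y ^ r) (i := 2) (by rwa [hfd]) (by rwa [hfd, hsub]) (by rwa [hfd, hsub]) (by
      rw [degreeOf_pow_eq' _ _ hs, degreeOf_pow_eq' _ _ hr]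
      simpa [hs, hr] using hxy)
  have hc0 : c ≠ 0 := by
    rintro rfl
    rw [hfc, hfd] at hf0'
    simp at hf0'
    exact hg0 hf0'.1.symm
  refine ⟨s, r, g, f.leadingCoeff, c, has, hbr,
    exponent_eq_one_of_degreeOf_eq_zero hdet hxy hs hr hsr hc0 hc, hc0, ?_, ?_⟩
  · rw [hDeq] at hD
    exact_mod_cast hD
  · have : ((g : ℚ) * (s * r)) = D := by rw [hDeq]; push_cast; rfl
    rw [this, ← hp, ← hfp]
    rw [hfd] at hfc
    conv_lhs => rw [hfc]
    exact aeval_homogenize_C_mul_X_sub_C_pow _ _ _ _ _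

end Reduction

section Composition

variable {k : Type*} [Field k]

theorem pcomp_assoc (F G H : PolyPair k) : pcomp (pcomp F G) H = pcomp F (pcomp G H) := by
  have h : ∀ p : MvPolynomial (Fin 2) k, aeval ![H.1, H.2] (aeval ![G.1, G.2] p) =
      aeval ![aeval ![H.1, H.2] G.1, aeval ![H.1, H.2] G.2] p := fun p => by
    rw [← AlgHom.comp_apply, comp_aeval]
    congr 2
    ext1 i
    fin_cases i <;> rfl
  exact Prod.ext (h _) (h _)

theorem pcomp_idPair (F : PolyPair k) : pcomp F (idPair k) = F := by
  have h : ∀ p : MvPolynomial (Fin 2) k, aeval ![X 0, X 1] p = p := fun p => by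
    refine DFunLike.congr_fun (g := AlgHom.id k _) (algHom_ext fun i => ?_) p
    fin_cases i <;> simp
  exact Prod.ext (h _) (h _)

theorem idPair_pcomp (F : PolyPair k) : pcomp (idPair k) F = F := by
  simp [pcomp, idPair]

/-- The elementary polynomial maps, in either of the two variables. -/
def IsElementary (E : PolyPair k) : Prop :=
  (∃ p : Polynomial k, E = elemF p) ∨ ∃ p : Polynomial k, E = elemG p

theorem aeval_pair_aeval (F : PolyPair k) (q : MvPolynomial (Fin 2) k) (p : Polynomial k) :
    aeval ![F.1, F.2] (Polynomial.aeval q p) = Polynomial.aeval (aeval ![F.1, F.2] q) p :=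
  (Polynomial.aeval_algHom_apply _ _ _).symm

theorem pcomp_elemF (F : PolyPair k) (p : Polynomial k) :
    pcomp (elemF p) F = (F.1, F.2 + Polynomial.aeval F.1 p) := by
  simp only [pcomp, elemF, map_add, aeval_pair_aeval, aeval_X]
  rfl

theorem pcomp_elemG (F : PolyPair k) (p : Polynomial k) :
    pcomp (elemG p) F = (F.1 + Polynomial.aeval F.2 p, F.2) := by
  simp only [pcomp, elemG, map_add, aeval_pair_aeval, aeval_X]
  rfl

theorem IsElementary.exists_inverse {E : PolyPair k} (hE : IsElementary E) :
    ∃ E', IsElementary E' ∧ pcomp E E' = idPair k ∧ pcomp E' E = idPair k := by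
  rcases hE with ⟨p, rfl⟩ | ⟨p, rfl⟩
  · refine ⟨elemF (-p), Or.inl ⟨_, rfl⟩, ?_, ?_⟩ <;>
      rw [pcomp_elemF] <;> simp [elemF, idPair]
  · refine ⟨elemG (-p), Or.inr ⟨_, rfl⟩, ?_, ?_⟩ <;>
      rw [pcomp_elemG] <;> simp [elemG, idPair]

/-- `F` is the composition of elementary maps, followed by some `(aX, Y)` with `a ≠ 0`. -/
def IsTame (F : PolyPair k) : Prop :=
  ∃ (a : k) (l : List (PolyPair k)), a ≠ 0 ∧ (∀ E ∈ l, IsElementary E) ∧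
    F = pcomp (C a * X 0, X 1) (l.foldr pcomp (idPair k))

theorem foldr_pcomp_append (l : List (PolyPair k)) (E : PolyPair k) :
    (l ++ [E]).foldr pcomp (idPair k) = pcomp (l.foldr pcomp (idPair k)) E := by
  induction l with
  | nil => simp [pcomp_idPair, idPair_pcomp]
  | cons H l ih => simp [ih, pcomp_assoc]

theorem IsTame.pcomp {F E : PolyPair k} (hF : IsTame F) (hE : IsElementary E) :
    IsTame (pcomp F E) := by
  obtain ⟨a, l, ha, hl, rfl⟩ := hF
  refine ⟨a, l ++ [E], ha, fun H hH => ?_, by rw [foldr_pcomp_append, pcomp_assoc]⟩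
  rcases List.mem_append.mp hH with h | h
  · exact hl H h
  · rwa [List.mem_singleton.mp h]

theorem IsTame.of_pcomp {F E : PolyPair k} (h : IsTame (_root_.pcomp F E)) (hE : IsElementary E) :
    IsTame F := by
  obtain ⟨E', hE', h1, -⟩ := hE.exists_inverse
  have := h.pcomp hE'
  rwa [pcomp_assoc, h1, pcomp_idPair] at this

theorem isTame_of_triangular {α β γ : k} (hα : α ≠ 0) (hγ : γ ≠ 0) (h : Polynomial k) :
    IsTame (C α * X 0 + C β, C γ * X 1 + Polynomial.aeval (X 0) h) := by
  let lin : k → k → k → k → PolyPair k := fun p q r s =>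
    (C p * X 0 + C q * X 1, C r * X 0 + C s * X 1)
  have hG : ∀ {p q r s : k} (t : k), IsTame (lin p q r s) →
      IsTame (lin p (p * t + q) r (r * t + s)) := by
    intro p q r s t hl
    have := hl.pcomp (Or.inr ⟨Polynomial.C t * Polynomial.X, rfl⟩)
    convert this using 1
    simp only [_root_.pcomp, elemG, lin, Prod.mk.injEq]
    simp [algebraMap_eq]
    constructor <;> ring
  have hF : ∀ {p q r s : k} (t : k), IsTame (lin p q r s) →
      IsTame (lin (p + q * t) q (r + s * t) s) := by
    intro p q r s t hl
    have := hl.pcomp (Or.inl ⟨Polynomial.C t * Polynomial.X, rfl⟩)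
    convert this using 1
    simp only [_root_.pcomp, elemF, lin, Prod.mk.injEq]
    simp [algebraMap_eq]
    constructor <;> ring
  have h0 : IsTame (lin (α * γ) 0 0 1) :=
    ⟨α * γ, [], mul_ne_zero hα hγ, by simp, by simp [lin, pcomp_idPair]⟩
  have hdiag : IsTame (lin α 0 0 γ) := by
    convert hG (-1) (hF 1 (hG (γ⁻¹ - 1) (hF (-γ) (hG γ⁻¹ h0)))) using 2 <;> field_simp <;> ring
  have := (hdiag.pcomp (Or.inr ⟨Polynomial.C (β / α), rfl⟩)).pcomp
    (Or.inl ⟨Polynomial.C γ⁻¹ * h, rfl⟩)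
  convert this using 1
  simp only [_root_.pcomp, elemF, elemG, lin, Prod.mk.injEq]
  simp [algebraMap_eq, mul_add, ← mul_assoc, ← C_mul, hγ, mul_div_cancel₀, hα]

end Composition

section Tame

variable {k : Type*} [Field k]

theorem degreeOf_lt_of_weightLE {p : MvPolynomial (Fin 2) k} {s r g : ℕ} (hs : s ≠ 0) (hr : r ≠ 0)
    (hp : WeightLE ![(r : ℚ), s] (g * (s * r)) p) :
    degreeOf 0 p ≤ g * s ∧ degreeOf 1 p ≤ g * r ∧
    (coeff (Finsupp.single 0 (g * s))
      (weightedHomogeneousComponent ![(r : ℚ), s] (g * (s * r)) p) = 0 →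
        g ≠ 0 → degreeOf 0 p < g * s) ∧
    (coeff (Finsupp.single 1 (g * r))
      (weightedHomogeneousComponent ![(r : ℚ), s] (g * (s * r)) p) = 0 →
        g ≠ 0 → degreeOf 1 p < g * r) := by
  have hle : ∀ m, coeff m p ≠ 0 → m 0 * r + m 1 * s ≤ g * (s * r) := fun m hm => by
    have := hp m hm
    rw [weight_fin_two] at this
    simp only [Matrix.cons_val_zero, Matrix.cons_val_one] at this
    exact_mod_cast this
  have h0 : ∀ m, coeff m p ≠ 0 → m 0 ≤ g * s := fun m hm => by
    refine Nat.le_of_mul_le_mul_right ?_ (Nat.pos_of_ne_zero hr)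
    have := hle m hm
    nlinarith
  have h1 : ∀ m, coeff m p ≠ 0 → m 1 ≤ g * r := fun m hm => by
    refine Nat.le_of_mul_le_mul_right ?_ (Nat.pos_of_ne_zero hs)
    have := hle m hm
    nlinarith
  refine ⟨degreeOf_le_iff.mpr fun m hm => h0 m (mem_support_iff.mp hm),
    degreeOf_le_iff.mpr fun m hm => h1 m (mem_support_iff.mp hm), fun hc hg => ?_, fun hc hg => ?_⟩
  · refine (degreeOf_lt_iff (by positivity)).mpr fun m hm => ?_
    have hm' := mem_support_iff.mp hm
    refine lt_of_le_of_ne (h0 m hm') fun h => ?_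
    have hle' := hle m hm'
    rw [h] at hle'
    have h' : m 1 * s ≤ 0 := by nlinarith
    have h'' : m 1 = 0 := by simpa [hs] using h'
    have hm_eq : m = Finsupp.single 0 (g * s) := by
      ext i
      fin_cases i
      · simpa using h
      · simpa using h''
    rw [coeff_weightedHomogeneousComponent, if_pos, ← hm_eq] at hc
    · exact hm' hc
    · rw [weight_fin_two]; simp; ring
  · refine (degreeOf_lt_iff (by positivity)).mpr fun m hm => ?_
    have hm' := mem_support_iff.mp hm
    refine lt_of_le_of_ne (h1 m hm') fun h => ?_
    have hle' := hle m hm'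
    rw [h] at hle'
    have h' : m 0 * r ≤ 0 := by nlinarith
    have h'' : m 0 = 0 := by simpa [hr] using h'
    have hm_eq : m = Finsupp.single 1 (g * r) := by
      ext i
      fin_cases i
      · simpa using h''
      · simpa using h
    rw [coeff_weightedHomogeneousComponent, if_pos, ← hm_eq] at hc
    · exact hm' hc
    · rw [weight_fin_two]; simp; ring

theorem coeff_single_C_mul_X_pow {σ : Type*} {i j : σ} (hij : i ≠ j) (a : k) (n : ℕ) {m : ℕ}
    (hm : m ≠ 0) : coeff (Finsupp.single i n) (C a * X j ^ m) = 0 := by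
  classical
  rw [coeff_C_mul, coeff_X_pow, if_neg, mul_zero]
  intro h
  have := DFunLike.congr_fun h j
  rw [Finsupp.single_eq_same, Finsupp.single_eq_of_ne hij.symm] at this
  exact hm this

theorem isWeightedHomogeneous_X_add_C_mul_X_pow {w : Fin 2 → ℚ} {i j : Fin 2} {n : ℕ} (c : k)
    (h : n * w j = w i) : IsWeightedHomogeneous w (X i + C c * X j ^ n) (w i) := by
  refine (isWeightedHomogeneous_X k w i).add ?_
  have := (isWeightedHomogeneous_C w c).mul ((isWeightedHomogeneous_X k w j).pow n)
  rwa [zero_add, nsmul_eq_mul, h] at this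

theorem exists_elementary_degreeOf_lt {F G : PolyPair k} (hFG : pcomp F G = idPair k)
    (hGF : pcomp G F = idPair k) (h0 : degreeOf 0 F.1 ≠ 0) (h1 : degreeOf 1 F.1 ≠ 0) :
    ∃ E, IsElementary E ∧ degreeOf 0 (pcomp F E).1 + degreeOf 1 (pcomp F E).1 <
      degreeOf 0 F.1 + degreeOf 1 F.1 := by
  classical
  obtain ⟨s, r, g, L, c, has, hbr, hsr, hc, hle, hcomp⟩ := exists_leadingForm_eq hFG hGF h0 h1
  have hg0 : g ≠ 0 := fun h => h0 (by rw [has, h, zero_mul])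
  have hs : s ≠ 0 := fun h => h0 (by rw [has, h, mul_zero])
  have hr : r ≠ 0 := fun h => h1 (by rw [hbr, h, mul_zero])
  have key : ∀ E : PolyPair k, IsWeightedHomogeneous ![(r : ℚ), s] E.1 r →
      IsWeightedHomogeneous ![(r : ℚ), s] E.2 s →
      WeightLE ![(r : ℚ), s] (g * (s * r)) (pcomp F E).1 ∧
      weightedHomogeneousComponent ![(r : ℚ), s] (g * (s * r)) (pcomp F E).1 =
        C L * (E.1 ^ s - C c * E.2 ^ r) ^ g := by
    intro E hE1 hE2
    have h := weightLE_aeval_and_component (w := ![(r : ℚ), s]) (v := ![(r : ℚ), s])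
      (x := ![E.1, E.2]) (fun i => by
        fin_cases i
        · exact fun m hm => (hE1 hm).le
        · exact fun m hm => (hE2 hm).le) hle
    refine ⟨h.1, h.2.trans ?_⟩
    have hx : (fun i => weightedHomogeneousComponent ![(r : ℚ), s] (![(r : ℚ), s] i)
        (![E.1, E.2] i)) = ![E.1, E.2] := by
      funext i
      fin_cases i
      · exact hE1.weightedHomogeneousComponent_same
      · exact hE2.weightedHomogeneousComponent_same
    rw [hx, hcomp]
    simp [algebraMap_eq]
  rcases hsr with rfl | rfl
  · refine ⟨elemG (Polynomial.C c * Polynomial.X ^ r), Or.inr ⟨_, rfl⟩, ?_⟩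
    obtain ⟨hk1, hk2⟩ := key (elemG (Polynomial.C c * Polynomial.X ^ r)) (by
        simpa [elemG, algebraMap_eq] using isWeightedHomogeneous_X_add_C_mul_X_pow
          (w := ![(r : ℚ), (1 : ℕ)]) (i := 0) (j := 1) (n := r) c (by simp))
      (isWeightedHomogeneous_X k ![(r : ℚ), (1 : ℕ)] 1)
    obtain ⟨h2, -, -, h3⟩ := degreeOf_lt_of_weightLE hs hr hk1
    have := h3 (by
      rw [hk2]
      simp only [elemG, map_mul, map_pow, Polynomial.aeval_C, Polynomial.aeval_X, algebraMap_eq,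
        pow_one, add_sub_cancel_right]
      exact coeff_single_C_mul_X_pow (by decide) _ _ hg0)
      hg0
    omega
  · refine ⟨elemF (Polynomial.C c⁻¹ * Polynomial.X ^ s), Or.inl ⟨_, rfl⟩, ?_⟩
    obtain ⟨hk1, hk2⟩ := key (elemF (Polynomial.C c⁻¹ * Polynomial.X ^ s))
      (isWeightedHomogeneous_X k ![((1 : ℕ) : ℚ), s] 0) (by
        simpa [elemF, algebraMap_eq] using isWeightedHomogeneous_X_add_C_mul_X_pow
          (w := ![((1 : ℕ) : ℚ), s]) (i := 1) (j := 0) (n := s) c⁻¹ (by simp))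
    obtain ⟨-, h2, h3, -⟩ := degreeOf_lt_of_weightLE hs hr hk1
    have := h3 (by
      have hX : (X 0 : MvPolynomial (Fin 2) k) ^ s - C c * (X 1 + C c⁻¹ * X 0 ^ s) =
          - (C c * X 1) := by
        rw [mul_add, ← mul_assoc, ← C_mul, mul_inv_cancel₀ hc, C_1]; ring
      rw [hk2]
      simp only [elemF, map_mul, map_pow, Polynomial.aeval_C, Polynomial.aeval_X, algebraMap_eq,
        pow_one, hX]
      rw [← neg_mul, ← C_neg, mul_pow, ← C_pow, ← mul_assoc, ← C_mul]
      exact coeff_single_C_mul_X_pow (by decide) _ _ hg0)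
      hg0
    omega

end Tame

section BaseCase

variable {k : Type*} [Field k]

theorem exists_eq_C_mul_X_add_C {F G : PolyPair k} (hFG : pcomp F G = idPair k) (j : Fin 2)
    (h : ∀ i, i ≠ j → degreeOf i F.1 = 0) :
    ∃ α β : k, α ≠ 0 ∧ F.1 = C α * X j + C β := by
  have hvars : ∀ i ∈ F.1.vars, i = j := fun i hi => by
    by_contra hij
    exact mem_vars_iff_degreeOf_ne_zero.mp hi (h i hij)
  have haeval : ∀ {A : Type _} [CommRing A] [Algebra k A] (x : Fin 2 → A),
      aeval x F.1 = Polynomial.aeval (x j) (aeval (fun _ => (Polynomial.X : Polynomial k)) F.1) := by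
    intro A _ _ x
    rw [← AlgHom.comp_apply, comp_aeval]
    refine hom_congr_vars (f₁ := (aeval x : MvPolynomial (Fin 2) k →ₐ[k] A).toRingHom)
      (f₂ := AlgHom.toRingHom _) (by ext; simp) (fun i hi _ => ?_) rfl
    simp [hvars i hi]
  set f := aeval (fun _ => (Polynomial.X : Polynomial k)) F.1 with hf
  let φ : MvPolynomial (Fin 2) k →ₐ[k] Polynomial k := aeval ![Polynomial.X, 0]
  have h1 : aeval ![G.1, G.2] F.1 = X 0 := congrArg Prod.fst hFG
  rw [haeval] at h1
  have h2 := congrArg φ h1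
  rw [← Polynomial.aeval_algHom_apply, aeval_X, ← Polynomial.comp_eq_aeval] at h2
  have h3 := congrArg Polynomial.natDegree h2
  rw [Polynomial.natDegree_comp] at h3
  simp only [Matrix.cons_val_zero, Polynomial.natDegree_X] at h3
  have hdeg : f.natDegree = 1 := Nat.eq_one_of_mul_eq_one_right h3
  obtain ⟨α, hα, β, hfab⟩ := Polynomial.natDegree_eq_one.mp hdeg
  refine ⟨α, β, hα, ?_⟩
  have h4 := haeval (X : Fin 2 → MvPolynomial (Fin 2) k)
  rw [aeval_X_left_apply, ← hfab] at h4
  simpa [algebraMap_eq] using h4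

theorem isTame_of_degreeOf_one_eq_zero {F G : PolyPair k} (hFG : pcomp F G = idPair k)
    (hGF : pcomp G F = idPair k) (h : degreeOf 1 F.1 = 0) : IsTame F := by
  obtain ⟨α, β, hα, hP⟩ := exists_eq_C_mul_X_add_C hFG 0 (fun i hi => by
    fin_cases i
    · exact absurd rfl hi
    · exact h)
  let ψ : MvPolynomial (Fin 2) k →ₐ[k] Polynomial (Polynomial k) :=
    aeval ![Polynomial.C Polynomial.X, Polynomial.X]
  let φ : Polynomial (Polynomial k) →+* MvPolynomial (Fin 2) k :=
    Polynomial.eval₂RingHom (Polynomial.aeval (X 0)).toRingHom (X 1)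
  have hφψ : ∀ p, φ (ψ p) = p := fun p => by
    refine DFunLike.congr_fun (f := φ.comp ψ.toRingHom) (g := RingHom.id _)
      (ringHom_ext (fun c => ?_) fun i => ?_) p
    · simp [φ, ψ, algebraMap_eq]
    · fin_cases i <;> simp [φ, ψ]
  set q := ψ F.2 with hq
  let v : Polynomial (Polynomial k) :=
    aeval ![Polynomial.C (Polynomial.C α * Polynomial.X + Polynomial.C β), Polynomial.X] G.2
  have hvq : v.comp q = Polynomial.X := by
    have h1 : aeval ![F.1, F.2] G.2 = X 1 := congrArg Prod.snd hGF
    have h2 := congrArg ψ h1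
    rw [← AlgHom.comp_apply, comp_aeval] at h2
    have h3 : ψ (X 1) = Polynomial.X := by simp [ψ]
    rw [← h3, ← h2]
    change Polynomial.compRingHom q (aeval _ G.2) = _
    refine DFunLike.congr_fun (f := (Polynomial.compRingHom q).comp (AlgHom.toRingHom (aeval _)))
      (g := AlgHom.toRingHom _) (ringHom_ext (fun c => ?_) fun i => ?_) G.2
    · simp [IsScalarTower.algebraMap_apply k (Polynomial k) (Polynomial (Polynomial k))]
    · fin_cases i
      · simp [hP, ψ, IsScalarTower.algebraMap_apply k (Polynomial k) (Polynomial (Polynomial k))]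
      · simp [hq]
  have hdeg : v.natDegree * q.natDegree = 1 := by
    rw [← Polynomial.natDegree_comp, hvq, Polynomial.natDegree_X]
  have hq1 : q.natDegree = 1 := Nat.eq_one_of_mul_eq_one_left hdeg
  have hv1 : v.natDegree = 1 := Nat.eq_one_of_mul_eq_one_right hdeg
  have hlead : v.leadingCoeff * q.leadingCoeff = 1 := by
    have := Polynomial.leadingCoeff_comp (p := v) (q := q) (by rw [hq1]; exact one_ne_zero)
    rw [hvq, hv1, pow_one, Polynomial.leadingCoeff_X] at this
    exact this.symm
  obtain ⟨γ, hγ, hγq⟩ := Polynomial.isUnit_iff.mp (IsUnit.of_mul_eq_one_right _ hlead)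
  have hQ : F.2 = C γ * X 1 + Polynomial.aeval (X 0) (q.coeff 0) := by
    have h1 : q = Polynomial.C (Polynomial.C γ) * Polynomial.X + Polynomial.C (q.coeff 0) := by
      conv_lhs => rw [Polynomial.eq_X_add_C_of_natDegree_le_one hq1.le]
      rw [hγq, Polynomial.leadingCoeff, hq1]
    rw [← hφψ F.2, ← hq]
    conv_lhs => rw [h1]
    simp [φ, algebraMap_eq]
  rw [show F = (F.1, F.2) from rfl, hP, hQ]
  exact isTame_of_triangular hα hγ.ne_zero _

theorem pcomp_pcomp_eq_idPair {F G E E' : PolyPair k} (h : pcomp F G = idPair k)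
    (hE : pcomp E E' = idPair k) : pcomp (pcomp F E) (pcomp E' G) = idPair k := by
  rw [pcomp_assoc, ← pcomp_assoc E, hE, idPair_pcomp, h]

theorem isTame_of_degreeOf_zero_eq_zero {F G : PolyPair k} (hFG : pcomp F G = idPair k)
    (hGF : pcomp G F = idPair k) (h : degreeOf 0 F.1 = 0) : IsTame F := by
  obtain ⟨α, β, hα, hP⟩ := exists_eq_C_mul_X_add_C hFG 1 (fun i hi => by
    fin_cases i
    · exact h
    · exact absurd rfl hi)
  have hE₁ : IsElementary (elemF (Polynomial.X : Polynomial k)) := Or.inl ⟨_, rfl⟩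
  have hE₂ : IsElementary (elemG (-Polynomial.X : Polynomial k)) := Or.inr ⟨_, rfl⟩
  obtain ⟨E₁, -, h1, h1'⟩ := hE₁.exists_inverse
  obtain ⟨E₂, -, h2, h2'⟩ := hE₂.exists_inverse
  refine ((isTame_of_degreeOf_one_eq_zero
    (pcomp_pcomp_eq_idPair (pcomp_pcomp_eq_idPair hFG h1) h2)
    (pcomp_pcomp_eq_idPair h2' (pcomp_pcomp_eq_idPair h1' hGF)) ?_).of_pcomp hE₂).of_pcomp hE₁
  have : (pcomp (pcomp F (elemF Polynomial.X)) (elemG (-Polynomial.X))).1 =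
      C α * X 0 + C β := by
    simp [pcomp, hP, elemF, elemG, algebraMap_eq]
  rw [this]
  refine Nat.le_zero.mp ((degreeOf_add_le _ _ _).trans ?_)
  rw [degreeOf_C_mul _ _ (mem_nonZeroDivisors_of_ne_zero hα)]
  simp [degreeOf_X]

theorem isTame_of_pcomp_eq_idPair {F G : PolyPair k} (hFG : pcomp F G = idPair k)
    (hGF : pcomp G F = idPair k) : IsTame F := by
  induction hn : degreeOf 0 F.1 + degreeOf 1 F.1 using Nat.strong_induction_on
    generalizing F G with
  | _ n ih =>
    by_cases h0 : degreeOf 0 F.1 = 0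
    · exact isTame_of_degreeOf_zero_eq_zero hFG hGF h0
    by_cases h1 : degreeOf 1 F.1 = 0
    · exact isTame_of_degreeOf_one_eq_zero hFG hGF h1
    obtain ⟨E, hE, hlt⟩ := exists_elementary_degreeOf_lt hFG hGF h0 h1
    obtain ⟨E', -, h2, h2'⟩ := hE.exists_inverse
    refine (ih _ (hn ▸ hlt) (pcomp_pcomp_eq_idPair hFG h2) ?_ rfl).of_pcomp hE
    rw [pcomp_assoc, ← pcomp_assoc G, hGF, idPair_pcomp, h2']

end BaseCase

section Jacobian

variable {k : Type*} [CommRing k]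

/-- The determinant of the Jacobian matrix of a polynomial map of the plane. -/
noncomputable def jacobianDet (F : PolyPair k) : MvPolynomial (Fin 2) k :=
  pderiv 0 F.1 * pderiv 1 F.2 - pderiv 1 F.1 * pderiv 0 F.2

theorem pderiv_aeval_pair (F : PolyPair k) (j : Fin 2) (p : MvPolynomial (Fin 2) k) :
    pderiv j (aeval ![F.1, F.2] p) = aeval ![F.1, F.2] (pderiv 0 p) * pderiv j F.1 +
      aeval ![F.1, F.2] (pderiv 1 p) * pderiv j F.2 := by
  induction p using MvPolynomial.induction_on with
  | C c => simp [algebraMap_eq]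
  | add p q hp hq => simp only [map_add, hp, hq]; ring
  | mul_X p i hp =>
    simp only [map_mul, Derivation.leibniz, hp, smul_eq_mul, map_add, aeval_X]
    fin_cases i <;> simp [pderiv_X] <;> ring

theorem jacobianDet_pcomp (F G : PolyPair k) :
    jacobianDet (pcomp F G) = aeval ![G.1, G.2] (jacobianDet F) * jacobianDet G := by
  simp only [jacobianDet, pcomp, pderiv_aeval_pair, map_sub, map_mul]
  ring

theorem jacobianDet_elemF (p : Polynomial k) : jacobianDet (elemF p) = 1 := by
  simp [jacobianDet, elemF, pderiv_X]

theorem jacobianDet_elemG (p : Polynomial k) : jacobianDet (elemG p) = 1 := by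
  simp [jacobianDet, elemG, pderiv_X]

theorem jacobianDet_idPair : jacobianDet (idPair k) = 1 := by
  simp [jacobianDet, idPair, pderiv_X]

theorem jacobianDet_C_mul_X (a : k) : jacobianDet (C a * X 0, X 1) = C a := by
  simp [jacobianDet, pderiv_X]

theorem jacobianDet_foldr_pcomp (l : List (PolyPair k))
    (hl : ∀ E ∈ l, (∃ p : Polynomial k, E = elemF p) ∨ ∃ p : Polynomial k, E = elemG p) :
    jacobianDet (l.foldr pcomp (idPair k)) = 1 := by
  induction l with
  | nil => exact jacobianDet_idPair
  | cons E l ih =>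
    rw [List.foldr_cons, jacobianDet_pcomp, ih fun H hH => hl H (List.mem_cons_of_mem _ hH)]
    rcases hl E List.mem_cons_self with ⟨p, rfl⟩ | ⟨p, rfl⟩
    · rw [jacobianDet_elemF, map_one, one_mul]
    · rw [jacobianDet_elemG, map_one, one_mul]

theorem CoeffsIn.exists_map_eq {R : Type*} [CommRing R] [Algebra R k]
    {p : MvPolynomial (Fin 2) k} (hp : CoeffsIn R p) : ∃ q, map (algebraMap R k) q = p := by
  refine mem_range_map_iff_coeffs_subset.mpr fun c hc => ?_
  obtain ⟨m, -, rfl⟩ := mem_coeffs_iff.mp hc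
  exact hp m

theorem constantCoeff_jacobianDet_mem_range {R : Type*} [CommRing R] [Algebra R k]
    {F : PolyPair k} (h1 : CoeffsIn R F.1) (h2 : CoeffsIn R F.2) :
    constantCoeff (jacobianDet F) ∈ Set.range (algebraMap R k) := by
  obtain ⟨P, hP⟩ := h1.exists_map_eq
  obtain ⟨Q, hQ⟩ := h2.exists_map_eq
  refine ⟨constantCoeff (jacobianDet (P, Q)), ?_⟩
  rw [← constantCoeff_map]
  simp only [jacobianDet, ← hP, ← hQ, pderiv_map, map_sub, map_mul]

end Jacobian

end TameAutomorphisms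

noncomputable section

/-- Let `R` be an integral domain with fraction field `K` and
`F ∈ Aut₂(R)`. Then there are `m ≥ 0`, `c, d ∈ R`, a unit `a` of `R` and
polynomial maps `F₁,…,F_m` over `K`, each of the form `(X, Y + f(X))` or
`(X + g(Y), Y)` with `f, g ∈ K[X]`, such that `F = L∘D_{a,1}∘F_m∘⋯∘F₁` where
`L = (X + c, Y + d)` and `D_{a,1} = (aX, Y)`. (The list `l` below records
`[F_m, …, F₁]`, so `m = l.length`, and `l.foldr pcomp (idPair K) = F_m∘⋯∘F₁`.) -/
theorem stmt_10 {R : Type*} [CommRing R] [IsDomain R]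
    (F : PolyPair (FractionRing R)) (hF : MemAut2 R F) :
    ∃ (c d a : R), IsUnit a ∧
      ∃ l : List (PolyPair (FractionRing R)),
        (∀ G ∈ l, (∃ p : Polynomial (FractionRing R), G = elemF p) ∨
                  (∃ p : Polynomial (FractionRing R), G = elemG p)) ∧
        F = pcomp
          (MvPolynomial.X 0 + MvPolynomial.C ((algebraMap R (FractionRing R)) c),
            MvPolynomial.X 1 + MvPolynomial.C ((algebraMap R (FractionRing R)) d))
          (pcomp
            (MvPolynomial.C ((algebraMap R (FractionRing R)) a) * MvPolynomial.X 0,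
              MvPolynomial.X 1)
            (l.foldr pcomp (idPair (FractionRing R)))) := by
  obtain ⟨hF1, hF2, G, hG1, hG2, hFG, hGF⟩ := hF
  obtain ⟨α, l, hα, hl, hFl⟩ := isTame_of_pcomp_eq_idPair hFG hGF
  have hjF : jacobianDet F = MvPolynomial.C α := by
    rw [hFl, jacobianDet_pcomp, jacobianDet_C_mul_X, jacobianDet_foldr_pcomp l hl,
      MvPolynomial.algHom_C, mul_one, MvPolynomial.algebraMap_eq]
  have hjG : α * MvPolynomial.constantCoeff (jacobianDet G) = 1 := by
    have h := congrArg (MvPolynomial.constantCoeff ∘ jacobianDet) hFG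
    simpa [jacobianDet_pcomp, hjF, jacobianDet_idPair] using h
  obtain ⟨a, ha⟩ := constantCoeff_jacobianDet_mem_range hF1 hF2
  obtain ⟨b, hb⟩ := constantCoeff_jacobianDet_mem_range hG1 hG2
  rw [hjF, MvPolynomial.constantCoeff_C] at ha
  refine ⟨0, 0, a, IsUnit.of_mul_eq_one b (IsFractionRing.injective R (FractionRing R) ?_), l, hl,
    ?_⟩
  · rw [map_mul, ha, hb, hjG, map_one]
  · rw [ha, ← hFl, map_zero, map_zero, add_zero, add_zero]
    exact (idPair_pcomp F).symm

end
end

section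
/- Let k be a field of characteristic zero, R = k[t] the polynomial ring in one variable, and K = k(t) its field of fractions. Let f, g ∈ K[X] with f(0) = g(0) = 0, set F₁ = (X, Y + f(X)) and G = (X + g(Y), Y), and let F = F₁⁻¹∘G∘F₁ (composition of polynomial maps over K, applying F₁ first). If F ∈ Aut₂(R), then F is stably tame with one more variable: the automorphism of R[X, Y, Z] acting as F on X, Y and fixing Z belongs to Tame₃(R). -/
noncomputable section

/-- `σ` is an affine automorphism of `S[X₁,…,Xₙ]`:
`Xᵢ ↦ Σⱼ aᵢⱼ Xⱼ + bᵢ` with `(aᵢⱼ) ∈ GLₙ(S)` and `bᵢ ∈ S`. -/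
def IsAffineAut {S : Type*} [CommRing S] {n : ℕ}
    (σ : MvPolynomial (Fin n) S ≃ₐ[S] MvPolynomial (Fin n) S) : Prop :=
  ∃ M : Matrix (Fin n) (Fin n) S, IsUnit M.det ∧ ∃ b : Fin n → S,
    ∀ i, σ (MvPolynomial.X i) =
      (∑ j, MvPolynomial.C (M i j) * MvPolynomial.X j) + MvPolynomial.C (b i)

/-- `σ` is an elementary automorphism of `S[X₁,…,Xₙ]`: it sends one variable `Xᵢ` to
`Xᵢ + f` where `f` is a polynomial in the remaining variables, and fixes the others. -/
def IsElementaryAut {S : Type*} [CommRing S] {n : ℕ}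
    (σ : MvPolynomial (Fin n) S ≃ₐ[S] MvPolynomial (Fin n) S) : Prop :=
  ∃ (i : Fin n) (f : MvPolynomial (Fin n) S),
    f ∈ MvPolynomial.supported S {j | j ≠ i} ∧
    σ (MvPolynomial.X i) = MvPolynomial.X i + f ∧
    ∀ j, j ≠ i → σ (MvPolynomial.X j) = MvPolynomial.X j

/-- The tame subgroup `Tameₙ(S)` of the group of `S`-algebra automorphisms of
`S[X₁,…,Xₙ]`, generated by the affine and the elementary automorphisms. -/
def TameSubgroup (S : Type*) [CommRing S] (n : ℕ) :
    Subgroup (MvPolynomial (Fin n) S ≃ₐ[S] MvPolynomial (Fin n) S) :=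
  Subgroup.closure {σ | IsAffineAut σ ∨ IsElementaryAut σ}

/-- `SL_m(S[X₁,…,Xₙ]) = E_m(S[X₁,…,Xₙ])` for all `n, m ≥ 0`: every matrix of
determinant one over every polynomial ring over `S` is a product of elementary
matrices (transvections). -/
def SLeqE (S : Type*) [CommRing S] : Prop :=
  ∀ (n m : ℕ) (M : Matrix.SpecialLinearGroup (Fin m) (MvPolynomial (Fin n) S)),
    M ∈ Subgroup.closure {A : Matrix.SpecialLinearGroup (Fin m) (MvPolynomial (Fin n) S) |
      ∃ (i j : Fin m) (c : MvPolynomial (Fin n) S), i ≠ j ∧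
        (A : Matrix (Fin m) (Fin m) (MvPolynomial (Fin n) S)) = Matrix.transvection i j c}


/-- `F` is stably tame over `R`: for some `m ≥ 0`, the automorphism of
`R[X, Y, Z₁,…,Z_m]` acting as `F` on `X, Y` and fixing `Z₁,…,Z_m` is tame. -/
def StablyTame (R : Type*) {K : Type*} [CommRing R] [CommRing K] [Algebra R K]
    (F : PolyPair K) : Prop :=
  ∃ (m : ℕ) (σ : MvPolynomial (Fin (2 + m)) R ≃ₐ[R] MvPolynomial (Fin (2 + m)) R),
    σ ∈ TameSubgroup R (2 + m) ∧
    MvPolynomial.map (algebraMap R K) (σ (MvPolynomial.X (Fin.castAdd m 0))) =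
      MvPolynomial.rename (Fin.castAdd m) F.1 ∧
    MvPolynomial.map (algebraMap R K) (σ (MvPolynomial.X (Fin.castAdd m 1))) =
      MvPolynomial.rename (Fin.castAdd m) F.2 ∧
    ∀ i : Fin m, σ (MvPolynomial.X (Fin.natAdd 2 i)) = MvPolynomial.X (Fin.natAdd 2 i)

section Divisibility

open Polynomial

variable {R : Type*} [CommRing R]

theorem C_dvd_of_C_dvd_comp_of_prime [IsDomain R] {q : R} (hq : Prime q)
    {p v : R[X]} (hp0 : p.coeff 0 = 0) (hp : ¬ C q ∣ p) (h : C q ∣ v.comp p) : C q ∣ v := by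
  have : (Ideal.span {q}).IsPrime := (Ideal.span_singleton_prime hq.ne_zero).2 hq
  have key (u : R[X]) : C q ∣ u ↔ u.map (Ideal.Quotient.mk (Ideal.span {q})) = 0 := by
    simp only [C_dvd_iff_dvd_coeff, Polynomial.ext_iff, coeff_map, coeff_zero,
      Ideal.Quotient.eq_zero_iff_mem, Ideal.mem_span_singleton]
  rw [key, Polynomial.map_comp, comp_eq_zero_iff] at h
  rw [key] at hp ⊢
  refine h.resolve_right fun h' => hp ?_
  rw [h'.2, coeff_map, hp0, map_zero, map_zero]

/-- If `c` divides `s * v(p)`, where `p(0) = 0` and neither `s` nor `p` vanishes modulo a prime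
factor of `c`, then `c` divides `v`. -/
theorem C_dvd_of_C_dvd_mul_comp [IsDomain R] [UniqueFactorizationMonoid R] {c : R} (hc : c ≠ 0)
    {p s : R[X]} (hp0 : p.coeff 0 = 0) (hp : ∀ q, Prime q → q ∣ c → ¬ C q ∣ p)
    (hs : ∀ q, Prime q → q ∣ c → ¬ C q ∣ s) :
    ∀ v : R[X], C c ∣ s * v.comp p → C c ∣ v := by
  induction c using UniqueFactorizationMonoid.induction_on_prime with
  | h₁ => exact absurd rfl hc
  | h₂ x hx => exact fun v _ => (hx.map C).dvd
  | h₃ c q hc' hq ih =>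
    intro v hv
    have hqs : C q ∣ s * v.comp p := (map_dvd C (dvd_mul_right q c)).trans hv
    obtain ⟨w, rfl⟩ := C_dvd_of_C_dvd_comp_of_prime hq hp0 (hp q hq (dvd_mul_right q c))
      (((prime_C_iff.2 hq).dvd_or_dvd hqs).resolve_left (hs q hq (dvd_mul_right q c)))
    have hCq : (C q : R[X]) ≠ 0 := C_ne_zero.2 hq.ne_zero
    rw [C_mul, mul_comp, C_comp, mul_left_comm, mul_dvd_mul_iff_left hCq] at hv
    rw [C_mul, mul_dvd_mul_iff_left hCq]
    exact ih hc' (fun r hr h => hp r hr (h.mul_left q)) (fun r hr h => hs r hr (h.mul_left q)) w hv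

theorem not_C_dvd_derivative [Algebra ℚ R] {q : R} {p : R[X]} (hp0 : p.coeff 0 = 0)
    (hp : ¬ C q ∣ p) : ¬ C q ∣ derivative p := by
  rw [C_dvd_iff_dvd_coeff] at hp ⊢
  refine fun h => hp fun n => ?_
  cases n with
  | zero => simp [hp0]
  | succ n =>
    have hn : IsUnit ((n : R) + 1) := by
      have : IsUnit ((n : ℚ) + 1) := (Nat.cast_add_one_ne_zero n).isUnit
      simpa using this.map (algebraMap ℚ R)
    have := h n
    rwa [coeff_derivative, hn.dvd_mul_right] at this

/-- A polynomial over a `ℚ`-algebra that vanishes at all natural numbers is zero. -/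
theorem eq_zero_of_eval_natCast_eq_zero [Algebra ℚ R] {P : R[X]}
    (h : ∀ m : ℕ, P.eval (m : R) = 0) : P = 0 := by
  ext n
  rw [coeff_zero, ← Module.forall_dual_apply_eq_zero_iff ℚ]
  intro l
  let Q : ℚ[X] := ∑ i ∈ Finset.range (P.natDegree + 1), monomial i (l (P.coeff i))
  have hQ : Q = 0 := by
    refine eq_zero_of_infinite_isRoot Q (Set.infinite_of_injective_forall_mem
      (f := fun m : ℕ => (m : ℚ)) Nat.cast_injective fun m => ?_)
    have := congrArg l (h m)
    rw [eval_eq_sum_range, map_sum, map_zero] at this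
    rw [Set.mem_ofPred_eq, IsRoot, eval_finsetSum, ← this]
    refine Finset.sum_congr rfl fun i _ => ?_
    have e : P.coeff i * (m : R) ^ i = ((m : ℚ) ^ i) • P.coeff i := by
      rw [Algebra.smul_def, mul_comm]; simp
    rw [eval_monomial, e, map_smul, smul_eq_mul, mul_comm]
  have := congrArg (coeff · n) hQ
  simp only [Q, finsetSum_coeff, coeff_monomial, coeff_zero, Finset.sum_ite_eq',
    Finset.mem_range] at this
  by_cases hn : n < P.natDegree + 1
  · simpa [hn] using this
  · rw [coeff_eq_zero_of_natDegree_lt (by omega), map_zero]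

theorem comp_sub_comp_mem {I : Ideal R[X]} (u : R[X]) {a b : R[X]} (h : a - b ∈ I) :
    u.comp a - u.comp b ∈ I := by
  rw [← Ideal.Quotient.eq] at h ⊢
  rw [comp, comp, hom_eval₂, hom_eval₂, h]

/-- If `p` is invariant modulo `c` under `X ↦ X + v(p)`, then `c` divides `p' * v(p)`. -/
theorem C_dvd_derivative_mul_comp [Algebra ℚ R] {c : R} {p v : R[X]}
    (h : C c ∣ p.comp (X + v.comp p) - p) : C c ∣ derivative p * v.comp p := by
  set I : Ideal R[X] := Ideal.span {C c}
  set r := v.comp p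
  rw [← Ideal.mem_span_singleton] at h ⊢
  have iter (m : ℕ) : p.comp (X + (m : R[X]) * r) - p ∈ I := by
    induction m with
    | zero => simp
    | succ m ih =>
      have hr : r.comp (X + r) - r ∈ I := by
        rw [show r.comp (X + r) = v.comp (p.comp (X + r)) from comp_assoc ..]
        exact comp_sub_comp_mem v h
      have h₁ : (p.comp (X + (m : R[X]) * r)).comp (X + r) - p.comp (X + r) ∈ I := by
        obtain ⟨w, hw⟩ := Ideal.mem_span_singleton.1 ih
        rw [← sub_comp, hw, mul_comp, C_comp]
        exact Ideal.mem_span_singleton.2 (dvd_mul_right _ _)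
      have h₂ : p.comp (X + ((m + 1 : ℕ) : R[X]) * r) -
          (p.comp (X + (m : R[X]) * r)).comp (X + r) ∈ I := by
        rw [comp_assoc]
        apply comp_sub_comp_mem
        have : X + ((m + 1 : ℕ) : R[X]) * r - (X + (m : R[X]) * r).comp (X + r) =
            -(m : R[X]) * (r.comp (X + r) - r) := by
          simp only [add_comp, mul_comp, natCast_comp, X_comp]
          push_cast
          ring
        rw [this]
        exact I.mul_mem_left _ hr
      have := I.add_mem (I.add_mem h₂ h₁) h
      simpa using this
  let π := Ideal.Quotient.mk I
  let P : R[X][X] := (p.map C).comp (C X + C r * X) - C p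
  have hP : P.map π = 0 := by
    refine eq_zero_of_eval_natCast_eq_zero fun m => ?_
    have e : P.eval (m : R[X]) = p.comp (X + (m : R[X]) * r) - p := by
      simp only [P, eval_sub, eval_comp, eval_add, eval_C, eval_mul, eval_X, eval_map]
      rw [mul_comm r]
      rfl
    rw [← map_natCast π, eval_map, eval₂_hom, e]
    exact Ideal.Quotient.eq_zero_iff_mem.2 (iter m)
  have hd : (derivative P).eval 0 = derivative p * r := by
    simp only [P, derivative_sub, derivative_C, sub_zero, derivative_comp, derivative_map]
    simp only [eval_mul, eval_comp, eval_add, eval_C, eval_X, derivative_add, derivative_mul,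
      derivative_C, derivative_X, eval_map]
    simp [eval₂_C_X, mul_comm]
  rw [← Ideal.Quotient.eq_zero_iff_mem, ← hd, ← eval₂_hom, ← eval_map, ← derivative_map, hP]
  simp

/-- Every polynomial over the fraction field is a quotient of an integral polynomial by a scalar
with no common prime factor. -/
theorem exists_reduced_C_mul_eq_map [IsDomain R] [UniqueFactorizationMonoid R]
    {K : Type*} [Field K] [Algebra R K] [IsFractionRing R K] (f : K[X]) :
    ∃ (d : R) (p : R[X]), d ≠ 0 ∧ p.map (algebraMap R K) = C (algebraMap R K d) * f ∧
      ∀ q, Prime q → q ∣ d → ¬ C q ∣ p := by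
  let S : Set R := {d | d ≠ 0 ∧ ∃ p : R[X], p.map (algebraMap R K) = C (algebraMap R K d) * f}
  have hS : S.Nonempty := by
    obtain ⟨b, hb, hbf⟩ := IsLocalization.integerNormalization_spec (nonZeroDivisors R) f
    refine ⟨b, nonZeroDivisors.ne_zero hb, _, hbf.trans ?_⟩
    rw [← algebraMap_smul K b f, smul_eq_C_mul]
  obtain ⟨d, ⟨hd, p, hp⟩, hmin⟩ :=
    wellFounded_dvdNotUnit (α := R).has_min S hS
  refine ⟨d, p, hd, hp, ?_⟩
  rintro q hq ⟨d', rfl⟩ ⟨p', rfl⟩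
  refine hmin d' ⟨right_ne_zero_of_mul hd, p', ?_⟩
    ⟨right_ne_zero_of_mul hd, q, hq.not_isUnit, mul_comm _ _⟩
  have hqK : C (algebraMap R K q) ≠ 0 :=
    C_ne_zero.2 ((map_ne_zero_iff _ (IsFractionRing.injective R K)).2 hq.ne_zero)
  apply mul_left_cancel₀ hqK
  rw [Polynomial.map_mul, map_C] at hp
  rw [hp, map_mul, C_mul, mul_assoc]

/-- If the integrality conditions forced by `(X, Y - f(X)) ∘ (X + g(Y), Y) ∘ (X, Y + f(X))` being
defined over `R` hold, then `f = p / d` and `g(Y) = d * h(d * Y)` with `p` and `h` integral. -/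
theorem exists_eq_div_of_integral [IsDomain R] [UniqueFactorizationMonoid R] [Algebra ℚ R]
    {K : Type*} [Field K] [Algebra R K] [IsFractionRing R K] {f g : K[X]} (hf0 : f.coeff 0 = 0)
    (hg : g ∈ Set.range (map (algebraMap R K)))
    (hgf : g.comp f ∈ Set.range (map (algebraMap R K)))
    (hf : f - f.comp (X + g.comp f) ∈ Set.range (map (algebraMap R K))) :
    ∃ (d : R) (p h : R[X]), d ≠ 0 ∧ p.map (algebraMap R K) = C (algebraMap R K d) * f ∧
      g = (C d * h.comp (C d * X)).map (algebraMap R K) := by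
  obtain ⟨d, p, hd, hp, hred⟩ := exists_reduced_C_mul_eq_map (R := R) f
  obtain ⟨g, rfl⟩ := hg
  obtain ⟨a, ha⟩ := hgf
  obtain ⟨b, hb⟩ := hf
  have hinj : Function.Injective (map (algebraMap R K)) :=
    map_injective _ (IsFractionRing.injective R K)
  have hdK : algebraMap R K d ≠ 0 := (map_ne_zero_iff _ (IsFractionRing.injective R K)).2 hd
  have hp0 : p.coeff 0 = 0 := by
    apply IsFractionRing.injective R K
    rw [← coeff_map, hp, coeff_C_mul, hf0, mul_zero, map_zero]
  have hscale : (g.scaleRoots d).comp p = C (d ^ g.natDegree) * a := by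
    apply hinj
    rw [Polynomial.map_comp, hp, Polynomial.map_mul, ha, comp, comp, eval₂_map, eval₂_map]
    have := scaleRoots_eval₂_mul (p := g) (C.comp (algebraMap R K)) f d
    rw [RingHom.comp_apply] at this
    rw [this]
    simp
  obtain ⟨v, hv⟩ : C (d ^ g.natDegree) ∣ g.scaleRoots d := by
    have hdvd (q : R) (hq : Prime q) (h : q ∣ d ^ g.natDegree) : q ∣ d := hq.dvd_of_dvd_pow h
    refine C_dvd_of_C_dvd_mul_comp (s := 1) (pow_ne_zero _ hd) hp0
      (fun q hq h => hred q hq (hdvd q hq h)) (fun q hq _ h => ?_) _ ?_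
    · exact hq.not_isUnit (isUnit_C.1 (isUnit_of_dvd_one h))
    · rw [one_mul, hscale]
      exact dvd_mul_right _ _
  have hvg : v.comp (C d * X) = g := by
    apply mul_left_cancel₀ (C_ne_zero.2 (pow_ne_zero g.natDegree hd))
    have := scaleRoots_eval₂_mul (p := g) (C : R →+* R[X]) X d
    rw [hv, eval₂_mul, eval₂_C, eval₂_C_X, ← C_pow] at this
    exact this
  have hvp : (v.comp p).map (algebraMap R K) = (g.map (algebraMap R K)).comp f := by
    rw [← hvg, Polynomial.map_comp, Polynomial.map_comp, comp_assoc, hp]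
    simp
  have hdv : C d ∣ v := by
    refine C_dvd_of_C_dvd_mul_comp hd hp0 hred
      (fun q hq h => not_C_dvd_derivative hp0 (hred q hq h)) v (C_dvd_derivative_mul_comp ?_)
    refine ⟨-b, hinj ?_⟩
    rw [Polynomial.map_sub, Polynomial.map_comp, Polynomial.map_add, hvp, Polynomial.map_mul,
      Polynomial.map_neg, hb, hp, mul_comp]
    simp
    ring
  obtain ⟨h, rfl⟩ := hdv
  refine ⟨d, p, h, hd, hp, ?_⟩
  rw [← hvg, mul_comp, C_comp]

end Divisibility

section Tame

open MvPolynomial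

variable {S : Type*} [CommRing S]

theorem X_mem_supported_of_mem {ι : Type*} {s : Set ι} {i : ι} (hi : i ∈ s) :
    (X i : MvPolynomial ι S) ∈ supported S s :=
  Algebra.subset_adjoin (Set.mem_image_of_mem X hi)

theorem aeval_mem_subalgebra {A : Type*} [CommRing A] [Algebra S A] {B : Subalgebra S A} {a : A}
    (ha : a ∈ B) (p : Polynomial S) : Polynomial.aeval a p ∈ B :=
  Algebra.adjoin_le (Set.singleton_subset_iff.2 ha) (Polynomial.aeval_mem_adjoin_singleton S a)

theorem aeval_update_eq_self {n : ℕ} {i : Fin n} {f : MvPolynomial (Fin n) S}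
    (hf : f ∈ supported S {j | j ≠ i}) (u : MvPolynomial (Fin n) S) :
    aeval (Function.update X i u) f = f := by
  conv_rhs => rw [← aeval_X_left_apply f]
  rw [mem_supported] at hf
  exact eval₂Hom_congr' rfl (fun j hj _ => Function.update_of_ne (hf hj) _ _) rfl

/-- The elementary automorphism `Xᵢ ↦ Xᵢ + f`. -/
def elementaryEquiv {n : ℕ} (i : Fin n) (f : MvPolynomial (Fin n) S)
    (hf : f ∈ supported S {j | j ≠ i}) : MvPolynomial (Fin n) S ≃ₐ[S] MvPolynomial (Fin n) S :=
  AlgEquiv.ofAlgHom (aeval (Function.update X i (X i + f))) (aeval (Function.update X i (X i - f)))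
    (by
      ext1 j
      obtain rfl | hj := eq_or_ne j i
      · simp [-aeval_eq_bind₁, aeval_update_eq_self hf]
      · simp [hj])
    (by
      ext1 j
      obtain rfl | hj := eq_or_ne j i
      · simp [-aeval_eq_bind₁, aeval_update_eq_self hf]
      · simp [hj])

section

variable {n : ℕ} {i : Fin n} {f : MvPolynomial (Fin n) S} (hf : f ∈ supported S {j | j ≠ i})

theorem elementaryEquiv_X_self : elementaryEquiv i f hf (X i) = X i + f := by
  simp [elementaryEquiv]

theorem elementaryEquiv_X_of_ne {j : Fin n} (hj : j ≠ i) : elementaryEquiv i f hf (X j) = X j := by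
  simp [elementaryEquiv, hj]

theorem elementaryEquiv_mem_tameSubgroup : elementaryEquiv i f hf ∈ TameSubgroup S n :=
  Subgroup.subset_closure (Or.inr ⟨i, f, hf, elementaryEquiv_X_self hf,
    fun _ hj => elementaryEquiv_X_of_ne hf hj⟩)

end

/-- The automorphism `exp(Z * D)` for `D = d * ∂/∂X - p'(X) * ∂/∂Y` exists and is tame; it fixes
`Z` and the kernel element `d * Y + p(X)`. -/
theorem exists_tame_shift (d : S) (p : Polynomial S) :
    ∃ E ∈ TameSubgroup S 3, E (X 0) = X 0 + C d * X 2 ∧ E (X 2) = X 2 ∧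
      E (C d * X 1 + Polynomial.aeval (X 0) p) = C d * X 1 + Polynomial.aeval (X 0) p := by
  let A := supported S {j : Fin 3 | j ≠ 1}
  let x : A := ⟨X 0, X_mem_supported_of_mem (by simp)⟩
  let z : A := ⟨X 2, X_mem_supported_of_mem (by simp)⟩
  obtain ⟨q, hq⟩ : algebraMap S A d ∣ Polynomial.aeval (x + algebraMap S A d * z) p -
      Polynomial.aeval x p := by
    refine (dvd_mul_right _ z).trans ?_
    have := Polynomial.sub_dvd_eval_sub (x + algebraMap S A d * z) x (p.map (algebraMap S A))
    simpa [Polynomial.eval_map_algebraMap] using this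
  replace hq := congrArg A.val hq
  simp only [map_sub, map_mul, ← Polynomial.aeval_algHom_apply, map_add, AlgHom.commutes] at hq
  change Polynomial.aeval (X 0 + C d * X 2) p - Polynomial.aeval (X 0) p = C d * q.1 at hq
  have hz : C d * X 2 ∈ supported S {j : Fin 3 | j ≠ 0} := by
    rw [← algebraMap_eq, ← Algebra.smul_def]
    exact Subalgebra.smul_mem _ (X_mem_supported_of_mem (by simp)) d
  let α := elementaryEquiv 0 (C d * X 2) hz
  let β := elementaryEquiv 1 (-q.1) (neg_mem q.2)
  have hα0 : α (X 0) = X 0 + C d * X 2 := elementaryEquiv_X_self hz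
  have hα1 : α (X 1) = X 1 := elementaryEquiv_X_of_ne hz (by decide)
  have hα2 : α (X 2) = X 2 := elementaryEquiv_X_of_ne hz (by decide)
  have hβ0 : β (X 0) = X 0 := elementaryEquiv_X_of_ne _ (by decide)
  have hβ1 : β (X 1) = X 1 + -q.1 := elementaryEquiv_X_self _
  have hβ2 : β (X 2) = X 2 := elementaryEquiv_X_of_ne _ (by decide)
  have hβC : β (C d) = C d := β.commutes d
  have hαC : α (C d) = C d := α.commutes d
  refine ⟨β * α, mul_mem (elementaryEquiv_mem_tameSubgroup _) (elementaryEquiv_mem_tameSubgroup _),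
    ?_, ?_, ?_⟩
  · simp only [AlgEquiv.mul_apply, hα0, map_add, map_mul, hβ0, hβ2, hβC]
  · rw [AlgEquiv.mul_apply, hα2, hβ2]
  · simp only [AlgEquiv.mul_apply, map_add, map_mul, hα1, hαC, hβC, hβ1, hβ2,
      ← Polynomial.aeval_algHom_apply, hα0, hβ0]
    linear_combination hq

/-- The commutator of `exp(Z * D)` with `Z ↦ Z + h(w)`, where `w = d * Y + p(X)`, is tame and
acts on `X, Y` as `exp(h(w) * D)`. -/
theorem exists_tame_commutator (d : S) (p h : Polynomial S) :
    ∃ σ ∈ TameSubgroup S 3,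
      σ (X 0) = X 0 + C d * Polynomial.aeval (C d * X 1 + Polynomial.aeval (X 0) p) h ∧
      C d * σ (X 1) + Polynomial.aeval (σ (X 0)) p = C d * X 1 + Polynomial.aeval (X 0) p ∧
      σ (X 2) = X 2 := by
  obtain ⟨E, hE, hE0, hE2, hEw⟩ := exists_tame_shift d p
  set w : MvPolynomial (Fin 3) S := C d * X 1 + Polynomial.aeval (X 0) p with hw
  let B := supported S {j : Fin 3 | j ≠ 2}
  have hwB : w ∈ B := by
    refine add_mem ?_ (aeval_mem_subalgebra (X_mem_supported_of_mem (by simp)) p)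
    rw [← algebraMap_eq, ← Algebra.smul_def]
    exact Subalgebra.smul_mem _ (X_mem_supported_of_mem (by simp)) d
  have hhw : Polynomial.aeval w h ∈ B := aeval_mem_subalgebra hwB h
  let T := elementaryEquiv 2 (Polynomial.aeval w h) hhw
  have hT0 : T (X 0) = X 0 := elementaryEquiv_X_of_ne hhw (by decide)
  have hT2 : T (X 2) = X 2 + Polynomial.aeval w h := elementaryEquiv_X_self hhw
  have hTw : T w = w := aeval_update_eq_self hwB _
  have hT0' : T⁻¹ (X 0) = X 0 := (T.symm_apply_eq).2 hT0.symm
  have hTw' : T⁻¹ w = w := (T.symm_apply_eq).2 hTw.symm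
  have hT2' : T⁻¹ (X 2) = X 2 - Polynomial.aeval w h := by
    refine (T.symm_apply_eq).2 ?_
    rw [map_sub, hT2, ← Polynomial.aeval_algHom_apply, hTw, add_sub_cancel_right]
  have hEw' : E⁻¹ w = w := (E.symm_apply_eq).2 hEw.symm
  have hE2' : E⁻¹ (X 2) = X 2 := (E.symm_apply_eq).2 hE2.symm
  have hEC (E : MvPolynomial (Fin 3) S ≃ₐ[S] MvPolynomial (Fin 3) S) : E (C d) = C d :=
    E.commutes d
  have hE0' : E⁻¹ (X 0) = X 0 - C d * X 2 := by
    refine (E.symm_apply_eq).2 ?_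
    rw [map_sub, map_mul, hE0, hE2, hEC, add_sub_cancel_right]
  have hTmem : T ∈ TameSubgroup S 3 := elementaryEquiv_mem_tameSubgroup hhw
  let σ := E⁻¹ * T * E * T⁻¹
  have hσw : σ w = w := by
    simp only [σ, AlgEquiv.mul_apply, hTw', hEw, hTw, hEw']
  refine ⟨σ, mul_mem (mul_mem (mul_mem (inv_mem hE) hTmem) hE) (inv_mem hTmem), ?_, ?_, ?_⟩
  · simp only [σ, AlgEquiv.mul_apply, hT0', hE0, map_add, map_mul, hT0, hEC, hT2, hE0', hE2',
      ← Polynomial.aeval_algHom_apply, hEw']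
    ring
  · conv_rhs => rw [← hσw, hw]
    rw [map_add, map_mul, hEC, ← Polynomial.aeval_algHom_apply]
  · simp only [σ, AlgEquiv.mul_apply, hT2', map_sub, map_add, hE2, hT2,
      ← Polynomial.aeval_algHom_apply, hEw, hTw, hE2', add_sub_cancel_right]

end Tame

section Integrality

open MvPolynomial

variable {R K : Type*} [CommRing R] [CommRing K] [Algebra R K]

theorem CoeffsIn.exists_map_eq_s11 {P : MvPolynomial (Fin 2) K} (hP : CoeffsIn R P) :
    ∃ Q, MvPolynomial.map (algebraMap R K) Q = P := by
  refine mem_range_map_iff_coeffs_subset.2 fun c hc => ?_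
  obtain ⟨m, -, rfl⟩ := mem_coeffs_iff.1 hc
  exact hP m

theorem CoeffsIn.aeval_mem_range_map {P : MvPolynomial (Fin 2) K} (hP : CoeffsIn R P)
    (u v : Polynomial R) :
    aeval ![u.map (algebraMap R K), v.map (algebraMap R K)] P ∈
      Set.range (Polynomial.map (algebraMap R K)) := by
  obtain ⟨Q, rfl⟩ := hP.exists_map_eq_s11
  refine ⟨aeval ![u, v] Q, ?_⟩
  clear hP
  induction Q using MvPolynomial.induction_on with
  | C a => simp [Polynomial.algebraMap_eq]
  | add p q hp hq => simp only [map_add, Polynomial.map_add, hp, hq]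
  | mul_X p i hp =>
    simp only [map_mul, Polynomial.map_mul, hp, map_X, aeval_X]
    fin_cases i <;> simp

theorem map_polynomial_aeval {ι : Type*} (q : MvPolynomial ι R) (p : Polynomial R) :
    MvPolynomial.map (algebraMap R K) (Polynomial.aeval q p) =
      Polynomial.aeval (MvPolynomial.map (algebraMap R K) q) (p.map (algebraMap R K)) := by
  rw [Polynomial.aeval_def, Polynomial.aeval_def, Polynomial.hom_eval₂, Polynomial.eval₂_map]
  congr 1
  ext a
  simp [algebraMap_eq]

/-- If `F = F₁⁻¹ ∘ G ∘ F₁` is defined over a factorial `ℚ`-algebra `R`, then its extension fixing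
one more variable is a tame automorphism over `R`. -/
theorem exists_tame_extension {R K : Type*} [CommRing R] [IsDomain R]
    [UniqueFactorizationMonoid R] [Algebra ℚ R] [Field K] [Algebra R K] [IsFractionRing R K]
    {f g : Polynomial K} {F : PolyPair K} (hF : F = pcomp (elemF (-f)) (pcomp (elemG g) (elemF f)))
    (hf0 : Polynomial.eval 0 f = 0) (hR₁ : CoeffsIn R F.1) (hR₂ : CoeffsIn R F.2) :
    ∃ σ : MvPolynomial (Fin 3) R ≃ₐ[R] MvPolynomial (Fin 3) R,
      σ ∈ TameSubgroup R 3 ∧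
      map (algebraMap R K) (σ (X 0)) = rename Fin.castSucc F.1 ∧
      map (algebraMap R K) (σ (X 1)) = rename Fin.castSucc F.2 ∧
      σ (X 2) = X 2 := by
  have hF1 : F.1 = X 0 +
      Polynomial.aeval (X 1 + Polynomial.aeval (X 0) f) g := by
    simp [hF, pcomp, elemF, elemG, ← Polynomial.aeval_algHom_apply]
  have hF2 : F.2 = X 1 + Polynomial.aeval (X 0) f -
      Polynomial.aeval F.1 f := by
    simp [hF, pcomp, elemF, elemG, ← Polynomial.aeval_algHom_apply, sub_eq_add_neg]
  have hf0' : f.coeff 0 = 0 := by rwa [Polynomial.coeff_zero_eq_eval_zero]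
  have hXY (u v : Polynomial K) : aeval ![u, v] F.1 = u + g.comp (v + f.comp u) := by
    rw [hF1, map_add, ← Polynomial.aeval_algHom_apply, map_add, ← Polynomial.aeval_algHom_apply,
      aeval_X, aeval_X]
    rfl
  have hXY' (u v : Polynomial K) : aeval ![u, v] F.2 =
      v + f.comp u - f.comp (u + g.comp (v + f.comp u)) := by
    rw [hF2, map_sub, ← Polynomial.aeval_algHom_apply, hXY, map_add,
      ← Polynomial.aeval_algHom_apply, aeval_X, aeval_X]
    rfl
  have hg : g ∈ Set.range (Polynomial.map (algebraMap R K)) := by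
    have := hR₁.aeval_mem_range_map 0 Polynomial.X
    rw [hXY, Polynomial.map_zero, Polynomial.map_X, Polynomial.comp_zero, hf0, Polynomial.C_0,
      add_zero, zero_add, Polynomial.comp_X] at this
    exact this
  have hgf : g.comp f ∈ Set.range (Polynomial.map (algebraMap R K)) := by
    obtain ⟨a, ha⟩ := hR₁.aeval_mem_range_map Polynomial.X 0
    refine ⟨a - Polynomial.X, ?_⟩
    rw [Polynomial.map_sub, ha, hXY]
    simp
  have hf : f - f.comp (Polynomial.X + g.comp f) ∈
      Set.range (Polynomial.map (algebraMap R K)) := by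
    have := hR₂.aeval_mem_range_map Polynomial.X 0
    rw [hXY'] at this
    simpa using this
  obtain ⟨d, p, h, hd, hp, hgh⟩ := exists_eq_div_of_integral hf0' hg hgf hf
  obtain ⟨σ, hσ, hσ0, hσ1, hσ2⟩ := exists_tame_commutator d p h
  have hren : (rename Fin.castSucc F.1 : MvPolynomial (Fin 3) K) =
      map (algebraMap R K) (σ (X 0)) := by
    rw [hF1, hσ0, hgh]
    simp only [map_add, map_mul, map_polynomial_aeval, hp, ← Polynomial.aeval_algHom_apply,
      Polynomial.map_mul, Polynomial.map_comp, Polynomial.map_C, Polynomial.map_X,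
      Polynomial.aeval_comp, Polynomial.aeval_C, Polynomial.aeval_X, rename_X, map_X, map_C,
      algebraMap_eq, mul_add, rename_C, Fin.castSucc_zero, Fin.castSucc_one]
  refine ⟨σ, hσ, hren.symm, ?_, hσ2⟩
  have hdK : (C (algebraMap R K d) : MvPolynomial (Fin 3) K) ≠ 0 :=
    C_ne_zero.2 ((map_ne_zero_iff _ (IsFractionRing.injective _ K)).2 hd)
  apply mul_left_cancel₀ hdK
  have := congrArg (map (algebraMap R K)) hσ1
  rw [map_add, map_polynomial_aeval, ← hren, map_add, map_polynomial_aeval, hp] at this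
  rw [hF2]
  simp only [map_mul, map_C, map_X, Polynomial.aeval_C, map_add, map_sub,
    algebraMap_eq, rename_X, Fin.castSucc_zero, Fin.castSucc_one,
    ← Polynomial.aeval_algHom_apply] at this ⊢
  linear_combination this

end Integrality

noncomputable section

/-- Let `k` be a field of characteristic zero, `R = k[t]`,
`K = k(t)`. Let `f, g ∈ K[X]` with `f(0) = g(0) = 0`, `F₁ = (X, Y + f(X))`,
`G = (X + g(Y), Y)`, and `F = F₁⁻¹∘G∘F₁`. If `F ∈ Aut₂(R)` then `F` is stably
tame with one more variable: the automorphism of `R[X,Y,Z]` acting as `F` on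
`X, Y` and fixing `Z` belongs to `Tame₃(R)`. -/
theorem stmt_11 {k : Type*} [Field k] [CharZero k]
    (f g : Polynomial (FractionRing (Polynomial k)))
    (hf0 : Polynomial.eval 0 f = 0) (hg0 : Polynomial.eval 0 g = 0)
    (hF : MemAut2 (Polynomial k) (pcomp (elemF (-f)) (pcomp (elemG g) (elemF f)))) :
    ∃ σ : MvPolynomial (Fin 3) (Polynomial k) ≃ₐ[Polynomial k]
        MvPolynomial (Fin 3) (Polynomial k),
      σ ∈ TameSubgroup (Polynomial k) 3 ∧
      MvPolynomial.map (algebraMap (Polynomial k) (FractionRing (Polynomial k)))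
          (σ (MvPolynomial.X 0)) =
        MvPolynomial.rename Fin.castSucc
          (pcomp (elemF (-f)) (pcomp (elemG g) (elemF f))).1 ∧
      MvPolynomial.map (algebraMap (Polynomial k) (FractionRing (Polynomial k)))
          (σ (MvPolynomial.X 1)) =
        MvPolynomial.rename Fin.castSucc
          (pcomp (elemF (-f)) (pcomp (elemG g) (elemF f))).2 ∧
      σ (MvPolynomial.X 2) = MvPolynomial.X 2 := by
  exact exists_tame_extension rfl hf0 hF.1 hF.2.1


end
end
end

section
/- Let R be a UFD with field of fractions K, and let t ∈ R be such that t and t+1 are both nonzero and neither is a unit of R. Set F₁ = (X, Y + (t+1)³X²/t) and G₁ = (X + t²Y/(t+1), Y), polynomial maps over K, and let F = G₁⁻¹∘F₁⁻¹∘G₁∘F₁ (applying F₁ first). Then both coordinate polynomials of F and of F⁻¹ have all coefficients in R, so F induces an R-algebra automorphism of R[X,Y], and this automorphism does not belong to Tame₂(R). -/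
noncomputable section

noncomputable section

/-- The length four polynomial map `F = G₁⁻¹∘F₁⁻¹∘G₁∘F₁` over `K = Frac(R)`, where
`F₁ = (X, Y + (t+1)³X²/t)` and `G₁ = (X + t²Y/(t+1), Y)`. -/
def exampleMap {R : Type*} [CommRing R] [IsDomain R] (t : R) :
    PolyPair (FractionRing R) :=
  let f := algebraMap R (FractionRing R)
  let F₁ := elemF (Polynomial.C ((f (t + 1)) ^ 3 / f t) * Polynomial.X ^ 2)
  let G₁ := elemG (Polynomial.C ((f t) ^ 2 / f (t + 1)) * Polynomial.X)
  let F₁inv := elemF (-(Polynomial.C ((f (t + 1)) ^ 3 / f t) * Polynomial.X ^ 2))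
  let G₁inv := elemG (-(Polynomial.C ((f t) ^ 2 / f (t + 1)) * Polynomial.X))
  pcomp G₁inv (pcomp F₁inv (pcomp G₁ F₁))

open MvPolynomial in
/-- The pair `(P', Q')` is the image of `(P, Q)` under an affine automorphism over `S`. -/
def AffineRel {S : Type*} [CommRing S] (P Q P' Q' : MvPolynomial (Fin 2) S) : Prop :=
  ∃ a b c d e f : S, IsUnit (a * d - b * c) ∧
    P' = C a * P + C b * Q + C e ∧ Q' = C c * P + C d * Q + C f

open MvPolynomial in
/-- Pairs obtained from `(X, Y)` by a reduced word in affine and triangular automorphisms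
over `S`: each triangular step is nonlinear and raises the degree. -/
inductive IsReducedPair {S : Type*} [CommRing S] :
    MvPolynomial (Fin 2) S → MvPolynomial (Fin 2) S → Prop
  | affine {P Q : MvPolynomial (Fin 2) S} (h : AffineRel (X 0) (X 1) P Q) : IsReducedPair P Q
  | step {P Q P' Q' : MvPolynomial (Fin 2) S} (h : IsReducedPair P Q)
      (hP : 1 ≤ P.totalDegree) (hQ : Q.totalDegree ≤ P.totalDegree)
      (p : Polynomial S) (hp : 2 ≤ p.natDegree)
      (h' : AffineRel P (Q + Polynomial.aeval P p) P' Q') : IsReducedPair P' Q'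

section Reduced

open MvPolynomial

variable {S : Type*} [CommRing S]

namespace AffineRel

variable {P Q P' Q' P'' Q'' : MvPolynomial (Fin 2) S}

theorem refl (P Q : MvPolynomial (Fin 2) S) : AffineRel P Q P Q :=
  ⟨1, 0, 0, 1, 0, 0, by simp, by simp, by simp⟩

theorem swap (P Q : MvPolynomial (Fin 2) S) : AffineRel P Q Q P :=
  ⟨0, 1, 1, 0, 0, 0, by simp, by simp, by simp⟩

theorem trans (h : AffineRel P Q P' Q') (h' : AffineRel P' Q' P'' Q'') :
    AffineRel P Q P'' Q'' := by
  obtain ⟨a, b, c, d, e, f, hu, rfl, rfl⟩ := h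
  obtain ⟨a', b', c', d', e', f', hu', rfl, rfl⟩ := h'
  refine ⟨a' * a + b' * c, a' * b + b' * d, c' * a + d' * c, c' * b + d' * d,
    a' * e + b' * f + e', c' * e + d' * f + f', ?_, ?_, ?_⟩
  · convert hu'.mul hu using 1
    ring
  · simp only [C_add, C_mul]
    ring
  · simp only [C_add, C_mul]
    ring

theorem symm (h : AffineRel P Q P' Q') : AffineRel P' Q' P Q := by
  obtain ⟨a, b, c, d, e, f, hu, rfl, rfl⟩ := h
  obtain ⟨u, hu⟩ := hu.exists_right_inv
  have hC : (C a * C d - C b * C c) * C u = (1 : MvPolynomial (Fin 2) S) := by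
    rw [← C_mul, ← C_mul, ← C_sub, ← C_mul, hu, C_1]
  refine ⟨u * d, -(u * b), -(u * c), u * a, u * (b * f - d * e), u * (c * e - a * f), ?_, ?_, ?_⟩
  · refine IsUnit.of_mul_eq_one (a * d - b * c) ?_
    linear_combination (u * (a * d - b * c) + 1) * hu
  · simp only [C_sub, C_mul, C_neg]
    linear_combination -P * hC
  · simp only [C_sub, C_mul, C_neg]
    linear_combination -Q * hC

theorem add_aeval (P Q : MvPolynomial (Fin 2) S) {p : Polynomial S} (hp : p.natDegree ≤ 1) :
    AffineRel P Q P (Q + Polynomial.aeval P p) := by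
  rw [Polynomial.eq_X_add_C_of_natDegree_le_one hp]
  refine ⟨1, 0, p.coeff 1, 1, 0, p.coeff 0, by simp, by simp, ?_⟩
  simp [MvPolynomial.algebraMap_eq]
  ring

theorem totalDegree_pos [Nontrivial S] (h : AffineRel P Q P' Q') (hP : 1 ≤ P.totalDegree) :
    1 ≤ max P'.totalDegree Q'.totalDegree := by
  by_contra! hlt
  have h0 : P'.totalDegree = 0 ∧ Q'.totalDegree = 0 := by
    constructor <;> omega
  obtain ⟨a, b, c, d, e, f, -, hP', -⟩ := h.symm
  rw [totalDegree_eq_zero_iff_eq_C.1 h0.1, totalDegree_eq_zero_iff_eq_C.1 h0.2, ← C_mul, ← C_mul,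
    ← C_add, ← C_add] at hP'
  rw [hP', totalDegree_C] at hP
  omega

end AffineRel

theorem totalDegree_C_mul_le {σ : Type*} (a : S) (P : MvPolynomial σ S) :
    (C a * P).totalDegree ≤ P.totalDegree := by
  simpa using totalDegree_mul (C a) P

theorem totalDegree_add_C {σ : Type*} (P : MvPolynomial σ S) (a : S) :
    (P + C a).totalDegree = P.totalDegree := by
  refine le_antisymm ((totalDegree_add _ _).trans (by simp)) ?_
  have h := totalDegree_sub_C_le (P + C a) a
  rwa [add_sub_cancel_right] at h

theorem totalDegree_C_mul [IsDomain S] {σ : Type*} {a : S} (ha : a ≠ 0) (P : MvPolynomial σ S) :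
    (C a * P).totalDegree = P.totalDegree := by
  rcases eq_or_ne P 0 with rfl | hP
  · simp
  · rw [totalDegree_mul_of_isDomain (by simpa using ha) hP, totalDegree_C, zero_add]

theorem totalDegree_pow_eq [IsDomain S] {σ : Type*} (P : MvPolynomial σ S) (n : ℕ) :
    (P ^ n).totalDegree = n * P.totalDegree := by
  rcases eq_or_ne P 0 with rfl | hP
  · rcases eq_or_ne n 0 with rfl | hn <;> simp [*]
  · induction n with
    | zero => simp
    | succ n ih => rw [pow_succ, totalDegree_mul_of_isDomain (pow_ne_zero n hP) hP, ih]; ring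

theorem totalDegree_aeval_le {σ : Type*} (P : MvPolynomial σ S) (p : Polynomial S) :
    (Polynomial.aeval P p).totalDegree ≤ p.natDegree * P.totalDegree := by
  rw [Polynomial.aeval_eq_sum_range]
  refine totalDegree_finsetSum_le fun i hi => ?_
  refine (totalDegree_smul_le _ _).trans ((totalDegree_pow _ _).trans ?_)
  exact Nat.mul_le_mul_right _ (Nat.lt_succ_iff.1 (Finset.mem_range.1 hi))

theorem totalDegree_aeval [IsDomain S] {σ : Type*} (P : MvPolynomial σ S) (p : Polynomial S) :
    (Polynomial.aeval P p).totalDegree = p.natDegree * P.totalDegree := by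
  refine le_antisymm (totalDegree_aeval_le P p) ?_
  rcases Nat.eq_zero_or_pos (p.natDegree * P.totalDegree) with h | h
  · omega
  have hd := Nat.pos_of_mul_pos_right h
  have hp : p ≠ 0 := by rintro rfl; simp at h
  have hlead : (C p.leadingCoeff * P ^ p.natDegree).totalDegree =
      p.natDegree * P.totalDegree := by
    rw [totalDegree_C_mul (by simpa using hp), totalDegree_pow_eq]
  have hlt : (Polynomial.aeval P p.eraseLead).totalDegree <
      (C p.leadingCoeff * P ^ p.natDegree).totalDegree := by
    rw [hlead]
    have := p.eraseLead_natDegree_le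
    refine (totalDegree_aeval_le P _).trans_lt (Nat.mul_lt_mul_of_pos_right ?_ ?_)
    · have := Nat.pos_of_mul_pos_right h
      have := Nat.pos_of_mul_pos_left h
      omega
    · by_contra! h0
      simp [Nat.le_zero.1 h0] at h
  conv_rhs => rw [← p.eraseLead_add_C_mul_X_pow]
  rw [map_add, map_mul, map_pow, Polynomial.aeval_X, Polynomial.aeval_C,
    MvPolynomial.algebraMap_eq, totalDegree_add_eq_right_of_totalDegree_lt hlt, hlead]

namespace IsReducedPair

variable {P Q P' Q' : MvPolynomial (Fin 2) S}

theorem trans (h : IsReducedPair P Q) (h' : AffineRel P Q P' Q') : IsReducedPair P' Q' := by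
  cases h with
  | affine h => exact .affine (h.trans h')
  | step h hP hQ p hp h'' => exact .step h hP hQ p hp (h''.trans h')

theorem totalDegree_pos [Nontrivial S] (h : IsReducedPair P Q) :
    1 ≤ max P.totalDegree Q.totalDegree := by
  cases h with
  | affine h => exact h.totalDegree_pos (by simp)
  | step h hP hQ p hp h' => exact h'.totalDegree_pos hP

theorem swap_iff : IsReducedPair P Q ↔ IsReducedPair Q P :=
  ⟨fun h => h.trans (.swap _ _), fun h => h.trans (.swap _ _)⟩

variable [IsDomain S]

/-- A reduced pair whose second component has larger degree ends in a triangular step. -/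
theorem exists_eq_add_aeval (h : IsReducedPair P Q) (hlt : P.totalDegree < Q.totalDegree) :
    ∃ (Q₀ : MvPolynomial (Fin 2) S) (p : Polynomial S), IsReducedPair P Q₀ ∧
      1 ≤ P.totalDegree ∧ Q₀.totalDegree ≤ P.totalDegree ∧ Q = Q₀ + Polynomial.aeval P p := by
  cases h with
  | affine h =>
    exfalso
    have hQ : Q.totalDegree ≤ 1 := by
      obtain ⟨a, b, c, d, e, f, -, -, rfl⟩ := h
      rw [totalDegree_add_C]
      refine (totalDegree_add _ _).trans (max_le ?_ ?_) <;>
        exact (totalDegree_C_mul_le _ _).trans (totalDegree_X _).le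
    obtain ⟨a, b, c, d, e, f, hu, rfl, rfl⟩ := h
    have h0 : (C a * X 0 + C b * X 1 + C e : MvPolynomial (Fin 2) S).totalDegree = 0 := by omega
    rw [totalDegree_add_C, totalDegree_eq_zero_iff_eq_C] at h0
    have ha := congrArg (coeff (Finsupp.single 0 1)) h0
    have hb := congrArg (coeff (Finsupp.single 1 1)) h0
    simp [coeff_C_mul, coeff_X, Finsupp.single_left_inj] at ha hb
    subst ha hb
    simp at hu
  | @step P₀ Q₀ _ _ h hP hQ p hp h' =>
    have hdeg : (Q₀ + Polynomial.aeval P₀ p).totalDegree = p.natDegree * P₀.totalDegree := by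
      rw [totalDegree_add_eq_right_of_totalDegree_lt, totalDegree_aeval]
      rw [totalDegree_aeval]
      nlinarith
    have hlt₀ : P₀.totalDegree < (Q₀ + Polynomial.aeval P₀ p).totalDegree := by
      rw [hdeg]
      nlinarith
    obtain ⟨a, b, c, d, e, f, hu, rfl, rfl⟩ := h'
    rw [totalDegree_add_C, totalDegree_add_C] at hlt
    have hb : b = 0 := by
      by_contra hb
      rw [totalDegree_add_eq_right_of_totalDegree_lt, totalDegree_C_mul hb] at hlt
      · exact hlt.not_ge ((totalDegree_add _ _).trans
          (max_le ((totalDegree_C_mul_le _ _).trans hlt₀.le) (totalDegree_C_mul_le _ _)))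
      · rw [totalDegree_C_mul hb]
        exact (totalDegree_C_mul_le _ _).trans_lt hlt₀
    subst hb
    rw [zero_mul, sub_zero] at hu
    obtain ⟨u, hau⟩ := (isUnit_of_mul_isUnit_left hu).exists_right_inv
    have ha : a ≠ 0 := (isUnit_of_mul_isUnit_left hu).ne_zero
    have hd := isUnit_of_mul_isUnit_right hu
    have hP' : C a * P₀ + C 0 * (Q₀ + Polynomial.aeval P₀ p) + C e = C a * P₀ + C e := by simp
    have hdP : (C a * P₀ + C e).totalDegree = P₀.totalDegree := by
      rw [totalDegree_add_C, totalDegree_C_mul ha]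
    rw [hP', hdP]
    refine ⟨C d * Q₀, (Polynomial.C c * Polynomial.X + Polynomial.C d * p + Polynomial.C f).comp
      (Polynomial.C u * (Polynomial.X - Polynomial.C e)),
      h.trans ⟨a, 0, 0, d, e, 0, by simpa using hu, by simp, by simp⟩, hP,
      (totalDegree_C_mul_le _ _).trans hQ, ?_⟩
    have hinv : Polynomial.aeval (C a * P₀ + C e)
        (Polynomial.C u * (Polynomial.X - Polynomial.C e)) = P₀ := by
      have hC : C a * C u = (1 : MvPolynomial (Fin 2) S) := by rw [← C_mul, hau, C_1]
      simp only [map_mul, map_sub, Polynomial.aeval_X, Polynomial.aeval_C,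
        MvPolynomial.algebraMap_eq]
      linear_combination P₀ * hC
    rw [Polynomial.aeval_comp, hinv]
    simp only [map_add, map_mul, Polynomial.aeval_X, Polynomial.aeval_C,
        MvPolynomial.algebraMap_eq]
    ring

theorem add_aeval (h : IsReducedPair P Q) (p : Polynomial S) :
    IsReducedPair P (Q + Polynomial.aeval P p) := by
  have key : ∀ {Q : MvPolynomial (Fin 2) S} (p : Polynomial S), IsReducedPair P Q →
      Q.totalDegree ≤ P.totalDegree → IsReducedPair P (Q + Polynomial.aeval P p) := by
    intro Q p h hQ
    rcases le_or_gt p.natDegree 1 with hp | hp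
    · exact h.trans (.add_aeval P Q hp)
    · exact .step h (by simpa [hQ] using h.totalDegree_pos) hQ p hp (.refl _ _)
  rcases le_or_gt Q.totalDegree P.totalDegree with hQ | hQ
  · exact key p h hQ
  · obtain ⟨Q₀, q, h₀, -, hQ₀, rfl⟩ := h.exists_eq_add_aeval hQ
    rw [add_assoc, ← map_add]
    exact key (q + p) h₀ hQ₀

theorem add_aeval_iff (p : Polynomial S) :
    IsReducedPair P (Q + Polynomial.aeval P p) ↔ IsReducedPair P Q :=
  ⟨fun h => by simpa using h.add_aeval (-p), fun h => h.add_aeval p⟩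

theorem mul_iff (ρ τ : MvPolynomial (Fin 2) S ≃ₐ[S] MvPolynomial (Fin 2) S)
    (hτ : IsAffineAut τ ∨ IsElementaryAut τ) :
    IsReducedPair ((ρ * τ) (X 0)) ((ρ * τ) (X 1)) ↔ IsReducedPair (ρ (X 0)) (ρ (X 1)) := by
  simp only [AlgEquiv.mul_apply]
  rcases hτ with ⟨M, hM, b, hτ⟩ | ⟨i, f, hf, hi, hj⟩
  · have hC (r : S) : ρ (C r) = C r := ρ.commutes r
    have h : AffineRel (ρ (X 0)) (ρ (X 1)) (ρ (τ (X 0))) (ρ (τ (X 1))) := by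
      refine ⟨M 0 0, M 0 1, M 1 0, M 1 1, b 0, b 1, by rwa [← Matrix.det_fin_two], ?_, ?_⟩ <;>
        simp [hτ, Fin.sum_univ_two, hC]
    exact ⟨fun h' => h'.trans h.symm, fun h' => h'.trans h⟩
  · have hex : ∀ k : Fin 2, {j | j ≠ i} = {k} → ∃ p : Polynomial S,
        Polynomial.aeval (X k) p = f := by
      intro k hk
      rw [hk, supported_eq_adjoin_X, Set.image_singleton,
        Algebra.adjoin_singleton_eq_range_aeval] at hf
      exact hf
    fin_cases i
    · obtain ⟨p, rfl⟩ := hex 1 (by ext j; fin_cases j <;> simp)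
      rw [hj 1 (by simp), swap_iff, swap_iff (P := ρ (X 0))]
      have : τ (X 0) = X 0 + Polynomial.aeval (X 1) p := hi
      rw [this, map_add, ← Polynomial.aeval_algHom_apply, add_aeval_iff]
    · obtain ⟨p, rfl⟩ := hex 0 (by ext j; fin_cases j <;> simp)
      have : τ (X 1) = X 1 + Polynomial.aeval (X 0) p := hi
      rw [hj 0 (by simp), this, map_add, ← Polynomial.aeval_algHom_apply, add_aeval_iff]

theorem of_mem_tameSubgroup {σ : MvPolynomial (Fin 2) S ≃ₐ[S] MvPolynomial (Fin 2) S}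
    (hσ : σ ∈ TameSubgroup S 2) : IsReducedPair (σ (X 0)) (σ (X 1)) := by
  induction hσ using Subgroup.closure_induction_right with
  | one => exact .affine (.refl _ _)
  | mul_right x _ y hy ih => exact (mul_iff x y hy).2 ih
  | mul_inv_cancel x _ y hy ih => exact (mul_iff (x * y⁻¹) y hy).1 (by simpa using ih)

end IsReducedPair

end Reduced

/-- The pair of polynomials obtained by mapping coefficients along a ring homomorphism. -/
def PolyPair.map {S T : Type*} [CommSemiring S] [CommSemiring T] (f : S →+* T) (F : PolyPair S) :
    PolyPair T :=
  (MvPolynomial.map f F.1, MvPolynomial.map f F.2)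

open MvPolynomial in
/-- The coordinates of `G₁⁻¹∘F₁⁻¹∘G₁∘F₁`, with denominators cleared. -/
def exampleFwd {S : Type*} [CommRing S] (t : S) : PolyPair S :=
  let A : MvPolynomial (Fin 2) S := C t * X 1 + C (t + 1) ^ 3 * X 0 ^ 2
  let B : MvPolynomial (Fin 2) S :=
    C (t + 1) * (2 * X 0 + C t * C (t + 1) ^ 2 * X 0 ^ 2) + C t ^ 2 * X 1
  (X 0 + C t * C (t + 1) ^ 2 * X 0 ^ 2 + C t ^ 2 * (A * B), X 1 - C (t + 1) * (A * B))

open MvPolynomial in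
/-- The coordinates of `F₁⁻¹∘G₁⁻¹∘F₁∘G₁`, with denominators cleared. -/
def exampleBwd {S : Type*} [CommRing S] (t : S) : PolyPair S :=
  let W : MvPolynomial (Fin 2) S := C (t + 1) * X 0 + C t ^ 2 * X 1
  (X 0 - C t * W ^ 2,
    X 1 + (C t * C (t + 1) * X 1 + C (t + 1) ^ 2 * W ^ 2) *
      (C (t + 1) * (2 * X 0 - C t * W ^ 2) + C t ^ 2 * X 1))

section Example

open MvPolynomial

variable {S : Type*} [CommRing S]

theorem coeffsIn_map_s12 {T : Type*} [CommRing T] [Algebra S T] (p : MvPolynomial (Fin 2) S) :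
    CoeffsIn S (MvPolynomial.map (algebraMap S T) p) := fun m => ⟨p.coeff m, (coeff_map _ p m).symm⟩

theorem pcomp_map {T : Type*} [CommRing T] (f : S →+* T) (F G : PolyPair S) :
    pcomp (F.map f) (G.map f) = (pcomp F G).map f := by
  have h (p : MvPolynomial (Fin 2) S) :
      aeval ![MvPolynomial.map f G.1, MvPolynomial.map f G.2] (MvPolynomial.map f p) =
        MvPolynomial.map f (aeval ![G.1, G.2] p) := by
    induction p using MvPolynomial.induction_on with
    | C a => simp [MvPolynomial.algebraMap_eq]
    | add p q hp hq => simp only [map_add, hp, hq]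
    | mul_X p i hp =>
      simp only [map_mul, hp, MvPolynomial.map_X, aeval_X]
      fin_cases i <;> rfl
  exact Prod.ext (h _) (h _)

theorem map_idPair {T : Type*} [CommRing T] (f : S →+* T) : (idPair S).map f = idPair T := by
  simp [PolyPair.map, idPair]

theorem exampleFwd_comp_exampleBwd (t : S) : pcomp (exampleFwd t) (exampleBwd t) = idPair S := by
  simp only [pcomp, exampleFwd, exampleBwd, idPair, Prod.mk.injEq, map_add, map_sub, map_mul,
    map_pow, aeval_X, aeval_C, MvPolynomial.algebraMap_eq, map_ofNat, map_one,
    Matrix.cons_val_zero, Matrix.cons_val_one]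
  constructor <;> ring

theorem exampleBwd_comp_exampleFwd (t : S) : pcomp (exampleBwd t) (exampleFwd t) = idPair S := by
  simp only [pcomp, exampleFwd, exampleBwd, idPair, Prod.mk.injEq, map_add, map_sub, map_mul,
    map_pow, aeval_X, aeval_C, MvPolynomial.algebraMap_eq, map_ofNat, map_one,
    Matrix.cons_val_zero, Matrix.cons_val_one]
  constructor <;> ring

/-- The automorphism of `S[X,Y]` given by `exampleFwd t`. -/
def exampleAut (t : S) : MvPolynomial (Fin 2) S ≃ₐ[S] MvPolynomial (Fin 2) S :=
  AlgEquiv.ofAlgHom (aeval ![(exampleFwd t).1, (exampleFwd t).2])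
    (aeval ![(exampleBwd t).1, (exampleBwd t).2])
    (algHom_ext fun i => by
      have h := exampleBwd_comp_exampleFwd t
      simp only [pcomp, idPair, Prod.mk.injEq] at h
      simp only [AlgHom.comp_apply, aeval_X, AlgHom.id_apply]
      fin_cases i
      exacts [h.1, h.2])
    (algHom_ext fun i => by
      have h := exampleFwd_comp_exampleBwd t
      simp only [pcomp, idPair, Prod.mk.injEq] at h
      simp only [AlgHom.comp_apply, aeval_X, AlgHom.id_apply]
      fin_cases i
      exacts [h.1, h.2])

theorem exampleMap_eq_map [IsDomain S] (t : S) (ht : t ≠ 0) (ht1 : t + 1 ≠ 0) :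
    exampleMap t = (exampleFwd t).map (algebraMap S (FractionRing S)) := by
  have hT : algebraMap S (FractionRing S) t ≠ 0 := by simpa using ht
  have hT1 : algebraMap S (FractionRing S) (t + 1) ≠ 0 :=
    (map_ne_zero_iff _ (IsFractionRing.injective S (FractionRing S))).2 ht1
  rw [map_add, map_one] at hT1
  have eq_of {T : FractionRing S} (hT : T ≠ 0) (hT1 : T + 1 ≠ 0) :
      (T + 1) ^ 3 / T * (T ^ 2 / (T + 1)) = T * (T + 1) ^ 2 ∧
      (T + 1) ^ 3 / T * T = (T + 1) ^ 3 ∧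
      T ^ 2 / (T + 1) * (T + 1) = T ^ 2 := by
    refine ⟨?_, ?_, ?_⟩ <;> field_simp
  obtain ⟨hab, ha, hb⟩ := eq_of hT hT1
  simp only [exampleMap, exampleFwd, PolyPair.map, elemF, elemG, pcomp, map_add, map_one, map_sub,
    map_mul, map_pow, map_neg, map_ofNat, aeval_X, aeval_C, Polynomial.aeval_X, Polynomial.aeval_C,
    MvPolynomial.map_X, MvPolynomial.map_C, MvPolynomial.algebraMap_eq, Matrix.cons_val_zero,
    Matrix.cons_val_one]
  generalize algebraMap S (FractionRing S) t = T at *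
  replace hab := congrArg (C (σ := Fin 2)) hab
  replace ha := congrArg (C (σ := Fin 2)) ha
  replace hb := congrArg (C (σ := Fin 2)) hb
  simp only [map_mul, map_add, map_pow, map_one] at hab ha hb
  generalize C (σ := Fin 2) ((T + 1) ^ 3 / T) = a at *
  generalize C (σ := Fin 2) (T ^ 2 / (T + 1)) = b at *
  generalize C (σ := Fin 2) T = T at *
  have key : a * (X 0 + b * (X 1 + a * X 0 ^ 2)) ^ 2 - a * X 0 ^ 2 =
      (T + 1) * ((T * X 1 + (T + 1) ^ 3 * X 0 ^ 2) *
        ((T + 1) * (2 * X 0 + T * (T + 1) ^ 2 * X 0 ^ 2) + T ^ 2 * X 1)) := by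
    linear_combination
      (X 1 + a * X 0 ^ 2) * (2 * X 0 + b * X 1 + (a * b + T * (T + 1) ^ 2) * X 0 ^ 2) * hab +
      (T + 1) ^ 2 * X 0 ^ 2 * (2 * X 0 + b * X 1 + T * (T + 1) ^ 2 * X 0 ^ 2) * ha +
      (T + 1) * (T * X 1 + (T + 1) ^ 3 * X 0 ^ 2) * X 1 * hb
  refine Prod.ext ?_ ?_ <;> dsimp only
  · linear_combination b * key + X 0 ^ 2 * hab + (T * X 1 + (T + 1) ^ 3 * X 0 ^ 2) *
      ((T + 1) * (2 * X 0 + T * (T + 1) ^ 2 * X 0 ^ 2) + T ^ 2 * X 1) * hb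
  · linear_combination -key

theorem exampleAut_notMem_tameSubgroup [IsDomain S] (t : S) (ht : t ≠ 0) (ht1 : t + 1 ≠ 0)
    (htu : ¬IsUnit t) : exampleAut t ∉ TameSubgroup S 2 := by
  intro hmem
  have hred := IsReducedPair.of_mem_tameSubgroup (inv_mem hmem)
  obtain ⟨W, hW⟩ : ∃ W : MvPolynomial (Fin 2) S, W = C (t + 1) * X 0 + C t ^ 2 * X 1 := ⟨_, rfl⟩
  obtain ⟨P, hP⟩ : ∃ P, P = (exampleBwd t).1 := ⟨_, rfl⟩
  obtain ⟨Q, hQ⟩ : ∃ Q, Q = (exampleBwd t).2 := ⟨_, rfl⟩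
  replace hred : IsReducedPair P Q := by
    have h0 : (exampleAut t)⁻¹ (X 0) = P := by
      rw [hP]; exact (aeval_X _ _).trans rfl
    have h1 : (exampleAut t)⁻¹ (X 1) = Q := by
      rw [hQ]; exact (aeval_X _ _).trans rfl
    rwa [h0, h1] at hred
  have hPW : P = X 0 - C t * W ^ 2 := by rw [hP, hW]; rfl
  have hQW : C t * Q = (C t * X 1 + C (t + 1) * W ^ 2) - C ((t + 1) ^ 3) * P ^ 2 := by
    rw [hPW, hQ, exampleBwd, hW]
    simp only [C_add, C_1, C_pow]
    ring
  have hdW : W.totalDegree = 1 := by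
    refine le_antisymm ?_ ?_
    · rw [hW, ← C_pow]
      refine (totalDegree_add _ _).trans (max_le ?_ ?_) <;>
        exact (totalDegree_C_mul_le _ _).trans (totalDegree_X _).le
    · by_contra! h
      have h0 := totalDegree_eq_zero_iff_eq_C.1 (Nat.lt_one_iff.1 h)
      have h1 := congrArg (coeff (Finsupp.single 0 1)) h0
      rw [hW, ← C_pow] at h1
      generalize t + 1 = u, t ^ 2 = v at h1 ht1
      simp [coeff_C_mul, coeff_X, Finsupp.single_left_inj] at h1
      exact ht1 h1
  have hdP : P.totalDegree = 2 := by
    have hlt : (X 0 : MvPolynomial (Fin 2) S).totalDegree < (-(C t * W ^ 2)).totalDegree := by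
      rw [totalDegree_neg, totalDegree_C_mul ht, totalDegree_pow_eq, hdW, totalDegree_X]
      norm_num
    rw [hPW, sub_eq_add_neg, totalDegree_add_eq_right_of_totalDegree_lt hlt, totalDegree_neg,
      totalDegree_C_mul ht, totalDegree_pow_eq, hdW]
  have hlow : (C t * X 1 + C (t + 1) * W ^ 2).totalDegree ≤ 2 := by
    refine (totalDegree_add _ _).trans (max_le ?_ ?_)
    · exact (totalDegree_C_mul_le _ _).trans (by simp)
    · exact (totalDegree_C_mul_le _ _).trans (by rw [totalDegree_pow_eq, hdW])
  have hdQ : Q.totalDegree = 4 := by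
    have hdP2 : (-(C ((t + 1) ^ 3) * P ^ 2)).totalDegree = 4 := by
      rw [totalDegree_neg, totalDegree_C_mul (pow_ne_zero 3 ht1), totalDegree_pow_eq, hdP]
    rw [← totalDegree_C_mul ht, hQW, sub_eq_add_neg, totalDegree_add_eq_right_of_totalDegree_lt,
      hdP2]
    omega
  obtain ⟨Q₀, p, -, -, hQ₀, hQp⟩ := hred.exists_eq_add_aeval (by omega)
  have haeval : Polynomial.aeval P
      (Polynomial.C ((t + 1) ^ 3) * Polynomial.X ^ 2 + Polynomial.C t * p) =
      (C t * X 1 + C (t + 1) * W ^ 2) - C t * Q₀ := by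
    simp only [map_add, map_mul, map_pow, Polynomial.aeval_X, Polynomial.aeval_C,
      MvPolynomial.algebraMap_eq]
    rw [hQp] at hQW
    simp only [map_add, map_pow] at hQW
    linear_combination hQW
  have hdeg := congrArg totalDegree haeval
  rw [totalDegree_aeval, hdP] at hdeg
  have hle : (C t * X 1 + C (t + 1) * W ^ 2 - C t * Q₀).totalDegree ≤ 2 :=
    (totalDegree_sub _ _).trans (max_le hlow ((totalDegree_C_mul_le _ _).trans (by omega)))
  have hcoeff := Polynomial.coeff_eq_zero_of_natDegree_lt
    (show (Polynomial.C ((t + 1) ^ 3) * Polynomial.X ^ 2 + Polynomial.C t * p).natDegree < 2 by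
      omega)
  rw [Polynomial.coeff_add, Polynomial.coeff_C_mul, Polynomial.coeff_X_pow, if_pos rfl,
    Polynomial.coeff_C_mul] at hcoeff
  exact htu (IsUnit.of_mul_eq_one (-(t ^ 2 + 3 * t + 3 + p.coeff 2)) (by
    linear_combination -hcoeff))

end Example

/-- Let `R` be a UFD with fraction field `K` and `t ∈ R` with
`t` and `t+1` nonzero non-units. With `F₁ = (X, Y + (t+1)³X²/t)`,
`G₁ = (X + t²Y/(t+1), Y)` and `F = G₁⁻¹∘F₁⁻¹∘G₁∘F₁`, both coordinate polynomials
of `F` and of `F⁻¹` have all coefficients in `R`, so `F` induces an `R`-algebra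
automorphism of `R[X,Y]`, and this automorphism is not in `Tame₂(R)`. -/
theorem stmt_12 {R : Type*} [CommRing R] [IsDomain R] [UniqueFactorizationMonoid R]
    (t : R) (ht : t ≠ 0) (ht1 : t + 1 ≠ 0) (htu : ¬IsUnit t) (ht1u : ¬IsUnit (t + 1)) :
    MemAut2 R (exampleMap t) ∧
    ∃ σ : MvPolynomial (Fin 2) R ≃ₐ[R] MvPolynomial (Fin 2) R,
      MvPolynomial.map (algebraMap R (FractionRing R)) (σ (MvPolynomial.X 0)) =
        (exampleMap t).1 ∧
      MvPolynomial.map (algebraMap R (FractionRing R)) (σ (MvPolynomial.X 1)) =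
        (exampleMap t).2 ∧
      σ ∉ TameSubgroup R 2 := by
  have hmap : exampleMap t = PolyPair.map (algebraMap R (FractionRing R)) (exampleFwd t) :=
    exampleMap_eq_map t ht ht1
  refine ⟨⟨?_, ?_, PolyPair.map (algebraMap R (FractionRing R)) (exampleBwd t), ?_, ?_, ?_, ?_⟩,
    exampleAut t, ?_, ?_, ?_⟩
  · rw [hmap]
    exact coeffsIn_map_s12 _
  · rw [hmap]
    exact coeffsIn_map_s12 _
  · exact coeffsIn_map_s12 _
  · exact coeffsIn_map_s12 _
  · rw [hmap, pcomp_map, exampleFwd_comp_exampleBwd, map_idPair]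
  · rw [hmap, pcomp_map, exampleBwd_comp_exampleFwd, map_idPair]
  · simp [hmap, exampleAut, PolyPair.map]
  · simp [hmap, exampleAut, PolyPair.map]
  · exact exampleAut_notMem_tameSubgroup t ht ht1 htu

end
end
end
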